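/- Let A be a finite idempotent algebra omitting type 1 every edge of which has the majority or the affine type. Then A has few subpowers. -/

import Mathlib

/-! Common framework: universal algebras over a fixed signature, terms,
subalgebras, congruences, quotients, edges and their types (Bulatov's
coloured-graph approach), thin edges, connectivity, products, etc. -/

/-- A (functional) signature: a type of operation symbols with arities. -/
structure Signature where
  ops : Type
  arity : ops → ℕ

/-- An algebra of a given signature. -/
structure UAlgebra (σ : Signature) where
  carrier : Type
  interp : ∀ f : σ.ops, (Fin (σ.arity f) → carrier) → carrier

/-- Terms over the signature `σ` in `n` variables. -/
inductive Term (σ : Signature) (n : ℕ) where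
  | var : Fin n → Term σ n
  | app : (f : σ.ops) → (Fin (σ.arity f) → Term σ n) → Term σ n

/-- Evaluation of a term in an algebra; term operations of an algebra are
exactly the operations of the form `Term.eval A t`. -/
def Term.eval {σ : Signature} {n : ℕ} (A : UAlgebra σ) :
    Term σ n → (Fin n → A.carrier) → A.carrier
  | .var i, x => x i
  | .app f ts, x => A.interp f fun j => Term.eval A (ts j) x

namespace UAlgebra

variable {σ : Signature}

/-- An algebra is idempotent if all its basic operations are. -/
def Idempotent (A : UAlgebra σ) : Prop :=
  ∀ (f : σ.ops) (a : A.carrier), A.interp f (fun _ => a) = a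

/-- A set closed under all basic operations. -/
def IsClosed (A : UAlgebra σ) (S : Set A.carrier) : Prop :=
  ∀ (f : σ.ops) (x : Fin (σ.arity f) → A.carrier), (∀ j, x j ∈ S) → A.interp f x ∈ S

/-- Closure of a set under the basic operations. -/
inductive Closure (A : UAlgebra σ) (S : Set A.carrier) : A.carrier → Prop
  | base {a : A.carrier} : a ∈ S → Closure A S a
  | app (f : σ.ops) (x : Fin (σ.arity f) → A.carrier) :
      (∀ j, Closure A S (x j)) → Closure A S (A.interp f x)

def ClosureSet (A : UAlgebra σ) (S : Set A.carrier) : Set A.carrier := {x | Closure A S x}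

theorem closureSet_isClosed (A : UAlgebra σ) (S : Set A.carrier) :
    A.IsClosed (A.ClosureSet S) := fun f x h => Closure.app f x h

/-- The subalgebra of `A` on a closed subset `S`. -/
def subalg (A : UAlgebra σ) (S : Set A.carrier) (hS : A.IsClosed S) : UAlgebra σ where
  carrier := {x : A.carrier // x ∈ S}
  interp f x := ⟨A.interp f fun j => (x j : A.carrier), hS f _ fun j => (x j).2⟩

/-- The subalgebra generated by a set `S`. -/
def Sg (A : UAlgebra σ) (S : Set A.carrier) : UAlgebra σ :=
  A.subalg (A.ClosureSet S) (A.closureSet_isClosed S)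

/-- `a` as an element of `Sg {a, b}`. -/
def sgA (A : UAlgebra σ) (a b : A.carrier) : (A.Sg {a, b}).carrier :=
  ⟨a, Closure.base (Set.mem_insert a {b})⟩

/-- `b` as an element of `Sg {a, b}`. -/
def sgB (A : UAlgebra σ) (a b : A.carrier) : (A.Sg {a, b}).carrier :=
  ⟨b, Closure.base (Set.mem_insert_iff.mpr (Or.inr rfl))⟩

/-- A congruence of an algebra. -/
structure Congruence (A : UAlgebra σ) where
  rel : A.carrier → A.carrier → Prop
  refl : ∀ x, rel x x
  symm : ∀ {x y}, rel x y → rel y x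
  trans : ∀ {x y z}, rel x y → rel y z → rel x z
  compat : ∀ (f : σ.ops) (x y : Fin (σ.arity f) → A.carrier),
      (∀ j, rel (x j) (y j)) → rel (A.interp f x) (A.interp f y)

def Congruence.toSetoid {A : UAlgebra σ} (θ : Congruence A) : Setoid A.carrier :=
  ⟨θ.rel, ⟨θ.refl, θ.symm, θ.trans⟩⟩

/-- The full congruence. -/
def Congruence.IsFull {A : UAlgebra σ} (θ : Congruence A) : Prop := ∀ x y, θ.rel x y

def Congruence.le {A : UAlgebra σ} (θ η : Congruence A) : Prop :=
  ∀ x y, θ.rel x y → η.rel x y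

/-- A maximal congruence: proper, and any congruence above it is full or below it. -/
def Congruence.IsMaximal {A : UAlgebra σ} (θ : Congruence A) : Prop :=
  ¬ θ.IsFull ∧ ∀ η : Congruence A, θ.le η → ¬ η.IsFull → η.le θ

/-- The quotient (factor) algebra. -/
noncomputable def quot (A : UAlgebra σ) (θ : Congruence A) : UAlgebra σ where
  carrier := Quotient θ.toSetoid
  interp f x := Quotient.mk θ.toSetoid (A.interp f fun j => (x j).out)

/-- The class of `a` in the quotient of `Sg {a,b}` by `θ`. -/
def qa (A : UAlgebra σ) (a b : A.carrier) (θ : Congruence (A.Sg {a, b})) :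
    ((A.Sg {a, b}).quot θ).carrier :=
  Quotient.mk θ.toSetoid (A.sgA a b)

def qb (A : UAlgebra σ) (a b : A.carrier) (θ : Congruence (A.Sg {a, b})) :
    ((A.Sg {a, b}).quot θ).carrier :=
  Quotient.mk θ.toSetoid (A.sgB a b)

end UAlgebra

/-- A binary operation is a semilattice operation on a set `B`. -/
def IsSemilatticeOn {α : Type} (f : α → α → α) (B : Set α) : Prop :=
  (∀ x ∈ B, f x x = x) ∧ (∀ x ∈ B, ∀ y ∈ B, f x y = f y x) ∧
    (∀ x ∈ B, ∀ y ∈ B, ∀ z ∈ B, f x (f y z) = f (f x y) z)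

/-- A ternary operation is a majority operation on a set `B`. -/
def IsMajorityOn {α : Type} (g : α → α → α → α) (B : Set α) : Prop :=
  ∀ x ∈ B, ∀ y ∈ B, g x x y = x ∧ g x y x = x ∧ g y x x = x

/-- A ternary operation is a Mal'tsev operation on a set `B`. -/
def IsMaltsevOn {α : Type} (h : α → α → α → α) (B : Set α) : Prop :=
  ∀ x ∈ B, ∀ y ∈ B, h x y y = x ∧ h y y x = x

namespace UAlgebra

variable {σ : Signature}

/-- An algebra is "a set": every term operation is a projection. -/
def IsSetAlgebra (Q : UAlgebra σ) : Prop :=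
  ∀ (n : ℕ) (t : Term σ n), ∃ i : Fin n, ∀ x : Fin n → Q.carrier, t.eval Q x = x i

/-- An algebra is the full idempotent reduct of a module over some finite ring:
its term operations are exactly the idempotent affine combinations; in
particular the affine operation `x - y + z` is a term operation. -/
def IsAffineAlgebra (Q : UAlgebra σ) : Prop :=
  ∃ (R : Type) (_ : Ring R) (_ : Finite R) (_ : AddCommGroup Q.carrier)
    (_ : Module R Q.carrier),
    (∀ (n : ℕ) (g : (Fin n → Q.carrier) → Q.carrier),
      (∃ t : Term σ n, ∀ x, t.eval Q x = g x) ↔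
      (∃ c : Fin n → R, (∑ i, c i) = 1 ∧ ∀ x, g x = ∑ i, c i • x i)) ∧
    (∃ t : Term σ 3, ∀ x y z : Q.carrier, t.eval Q ![x, y, z] = x - y + z)

/-- `θ` witnesses that `ab` is an edge of the unary type. -/
def UnaryWitness (A : UAlgebra σ) (a b : A.carrier) (θ : Congruence (A.Sg {a, b})) : Prop :=
  θ.IsMaximal ∧ IsSetAlgebra ((A.Sg {a, b}).quot θ)

/-- `θ` witnesses that `ab` is an edge of the semilattice type. -/
def SLWitness (A : UAlgebra σ) (a b : A.carrier) (θ : Congruence (A.Sg {a, b})) : Prop :=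
  θ.IsMaximal ∧ ∃ t : Term σ 2,
    IsSemilatticeOn (fun x y => t.eval ((A.Sg {a, b}).quot θ) ![x, y])
      {A.qa a b θ, A.qb a b θ}

/-- `θ` witnesses that `ab` is an edge of the majority type. -/
def MajWitness (A : UAlgebra σ) (a b : A.carrier) (θ : Congruence (A.Sg {a, b})) : Prop :=
  θ.IsMaximal ∧
  (∃ t : Term σ 3,
    IsMajorityOn (fun x y z => t.eval ((A.Sg {a, b}).quot θ) ![x, y, z])
      {A.qa a b θ, A.qb a b θ}) ∧
  ¬ (∃ t : Term σ 2,
    IsSemilatticeOn (fun x y => t.eval ((A.Sg {a, b}).quot θ) ![x, y])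
      {A.qa a b θ, A.qb a b θ})

/-- `θ` witnesses that `ab` is an edge of the affine type. -/
def AffWitness (A : UAlgebra σ) (a b : A.carrier) (θ : Congruence (A.Sg {a, b})) : Prop :=
  θ.IsMaximal ∧ IsAffineAlgebra ((A.Sg {a, b}).quot θ)

/-- A pair of distinct elements is an edge. -/
def IsEdge (A : UAlgebra σ) (a b : A.carrier) : Prop :=
  a ≠ b ∧ ∃ θ : Congruence (A.Sg {a, b}), ¬ θ.IsFull ∧
    (IsSetAlgebra ((A.Sg {a, b}).quot θ) ∨
     IsAffineAlgebra ((A.Sg {a, b}).quot θ) ∨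
     (∃ t : Term σ 2,
        IsSemilatticeOn (fun x y => t.eval ((A.Sg {a, b}).quot θ) ![x, y])
          {A.qa a b θ, A.qb a b θ}) ∨
     (∃ t : Term σ 3,
        IsMajorityOn (fun x y z => t.eval ((A.Sg {a, b}).quot θ) ![x, y, z])
          {A.qa a b θ, A.qb a b θ}))

def IsUnaryEdge (A : UAlgebra σ) (a b : A.carrier) : Prop :=
  a ≠ b ∧ ∃ θ : Congruence (A.Sg {a, b}), UnaryWitness A a b θ

def IsSLEdge (A : UAlgebra σ) (a b : A.carrier) : Prop :=
  a ≠ b ∧ ∃ θ : Congruence (A.Sg {a, b}), SLWitness A a b θ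

def IsMajEdge (A : UAlgebra σ) (a b : A.carrier) : Prop :=
  a ≠ b ∧ ∃ θ : Congruence (A.Sg {a, b}), MajWitness A a b θ

def IsAffEdge (A : UAlgebra σ) (a b : A.carrier) : Prop :=
  a ≠ b ∧ ∃ θ : Congruence (A.Sg {a, b}), AffWitness A a b θ

end UAlgebra

/-- The four types of edges. -/
inductive EdgeType where
  | unary | semilattice | majority | affine
deriving DecidableEq

namespace UAlgebra

variable {σ : Signature}

def HasEdgeOfType (A : UAlgebra σ) (τ : EdgeType) (a b : A.carrier) : Prop :=
  match τ with
  | .unary => A.IsUnaryEdge a b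
  | .semilattice => A.IsSLEdge a b
  | .majority => A.IsMajEdge a b
  | .affine => A.IsAffEdge a b

/-- `T`-restricted algebra: every edge has a type from `T`. -/
def Restricted (A : UAlgebra σ) (T : Set EdgeType) : Prop :=
  ∀ a b : A.carrier, A.IsEdge a b → ∃ τ ∈ T, A.HasEdgeOfType τ a b

/-- `A` omits type 1: no subalgebra of `A` has an edge of the unary type. -/
def OmitsType1 (A : UAlgebra σ) : Prop :=
  ∀ (S : Set A.carrier) (hS : A.IsClosed S) (a b : (A.subalg S hS).carrier),
    ¬ (A.subalg S hS).IsUnaryEdge a b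

/-- The union of the two `θ`-blocks of a thick edge, as a subset of `A`. -/
def edgeBlockUnion (A : UAlgebra σ) (a b : A.carrier) (θ : Congruence (A.Sg {a, b})) :
    Set A.carrier :=
  {x | ∃ hx : x ∈ A.ClosureSet {a, b},
    θ.rel ⟨x, hx⟩ (A.sgA a b) ∨ θ.rel ⟨x, hx⟩ (A.sgB a b)}

/-- Smooth algebra: for every semilattice- or majority-type edge with a witnessing
maximal congruence, the union of the two blocks is a subuniverse. -/
def IsSmooth (A : UAlgebra σ) : Prop :=
  ∀ (a b : A.carrier) (θ : Congruence (A.Sg {a, b})),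
    (SLWitness A a b θ ∨ MajWitness A a b θ) → A.IsClosed (A.edgeBlockUnion a b θ)

def SemilatticeFree (A : UAlgebra σ) : Prop := ∀ a b : A.carrier, ¬ A.IsSLEdge a b
def MajorityFree (A : UAlgebra σ) : Prop := ∀ a b : A.carrier, ¬ A.IsMajEdge a b
def AffineFree (A : UAlgebra σ) : Prop := ∀ a b : A.carrier, ¬ A.IsAffEdge a b

/-- Thin semilattice edge. -/
def IsThinSLEdge (A : UAlgebra σ) (a b : A.carrier) : Prop :=
  ∃ t : Term σ 2, t.eval A ![a, a] = a ∧ t.eval A ![a, b] = b ∧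
    t.eval A ![b, a] = b ∧ t.eval A ![b, b] = b

/-- Undirected thin majority edge: some term operation is majority on `{a, b}`. -/
def IsUndirThinMajEdge (A : UAlgebra σ) (a b : A.carrier) : Prop :=
  ∃ t : Term σ 3, IsMajorityOn (fun x y z => t.eval A ![x, y, z]) {a, b}

/-- Mal'tsev edge: some term operation is Mal'tsev on `{a, b}`. -/
def IsMaltsevEdge (A : UAlgebra σ) (a b : A.carrier) : Prop :=
  ∃ t : Term σ 3, IsMaltsevOn (fun x y z => t.eval A ![x, y, z]) {a, b}

/-- The class of all quotients of subalgebras of `A`. -/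
def QuotSub (A : UAlgebra σ) : Set (UAlgebra σ) :=
  {B | ∃ (S : Set A.carrier) (hS : A.IsClosed S)
        (θ : Congruence (A.subalg S hS)), B = (A.subalg S hS).quot θ}

end UAlgebra

/-- The class of all quotients of subalgebras of the algebras of a class. -/
def QuotSubClass {σ : Signature} (K : Set (UAlgebra σ)) : Set (UAlgebra σ) :=
  {B | ∃ A ∈ K, B ∈ UAlgebra.QuotSub A}

/-- A ternary term satisfies the majority condition relative to a class `𝒦`. -/
def MajorityCondition {σ : Signature} (𝒦 : Set (UAlgebra σ)) (t : Term σ 3) : Prop :=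
  (∀ B ∈ 𝒦, ∀ x y : B.carrier,
    t.eval B ![x, t.eval B ![x, y, y], t.eval B ![x, y, y]] = t.eval B ![x, y, y]) ∧
  (∀ B ∈ 𝒦, ∀ (a b : B.carrier) (θ : UAlgebra.Congruence (B.Sg {a, b})),
    a ≠ b → UAlgebra.MajWitness B a b θ →
    IsMajorityOn (fun x y z => t.eval ((B.Sg {a, b}).quot θ) ![x, y, z])
      {B.qa a b θ, B.qb a b θ})

/-- A ternary term satisfies the minority condition relative to a class `𝒦`. -/
def MinorityCondition {σ : Signature} (𝒦 : Set (UAlgebra σ)) (t : Term σ 3) : Prop :=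
  (∀ B ∈ 𝒦, ∀ x y : B.carrier,
    t.eval B ![t.eval B ![x, y, y], y, y] = t.eval B ![x, y, y]) ∧
  (∀ B ∈ 𝒦, ∀ (a b : B.carrier) (θ : UAlgebra.Congruence (B.Sg {a, b})),
    a ≠ b → UAlgebra.AffWitness B a b θ →
    IsMaltsevOn (fun x y z => t.eval ((B.Sg {a, b}).quot θ) ![x, y, z])
      {B.qa a b θ, B.qb a b θ})

/-- Thin majority edge relative to a class `𝒦`. -/
def IsThinMajEdge {σ : Signature} (𝒦 : Set (UAlgebra σ)) (A : UAlgebra σ)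
    (a b : A.carrier) : Prop :=
  ∀ t : Term σ 3, MajorityCondition 𝒦 t →
    b ∈ A.ClosureSet {a, t.eval A ![a, b, b]} ∧
    b ∈ A.ClosureSet {a, t.eval A ![b, a, b]} ∧
    b ∈ A.ClosureSet {a, t.eval A ![b, b, a]}

/-- Thin affine edge relative to a class `𝒦` (with respect to some fixed term
operation satisfying the minority condition). -/
def IsThinAffEdge {σ : Signature} (𝒦 : Set (UAlgebra σ)) (A : UAlgebra σ)
    (a b : A.carrier) : Prop :=
  (∃ t : Term σ 3, MinorityCondition 𝒦 t ∧ t.eval A ![b, a, a] = b) ∧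
  ∀ t : Term σ 3, MinorityCondition 𝒦 t → b ∈ A.ClosureSet {a, t.eval A ![a, a, b]}

namespace UAlgebra

variable {σ : Signature}

/-- Reachability in the digraph `Gs(A)` of thin semilattice edges. -/
def sReach (A : UAlgebra σ) : A.carrier → A.carrier → Prop :=
  Relation.ReflTransGen (fun x y => A.IsThinSLEdge x y)

/-- A maximal element of `Gs(A)`: an element of a maximal strongly connected
component. -/
def IsMaxElem (A : UAlgebra σ) (a : A.carrier) : Prop :=
  ∀ b, A.sReach a b → A.sReach b a

/-- A maximal component of `Gs(A)`: the strongly connected component of a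
maximal element. -/
def IsMaxComponent (A : UAlgebra σ) (C : Set A.carrier) : Prop :=
  ∃ a, A.IsMaxElem a ∧ C = {b | A.sReach a b ∧ A.sReach b a}

end UAlgebra

/-- An arc of the digraph `Gas(A)`: a thin semilattice or thin affine edge. -/
def asStep {σ : Signature} (𝒦 : Set (UAlgebra σ)) (A : UAlgebra σ)
    (x y : A.carrier) : Prop :=
  A.IsThinSLEdge x y ∨ IsThinAffEdge 𝒦 A x y

/-- Reachability in `Gas(A)`. -/
def asReach {σ : Signature} (𝒦 : Set (UAlgebra σ)) (A : UAlgebra σ) :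
    A.carrier → A.carrier → Prop :=
  Relation.ReflTransGen (asStep 𝒦 A)

/-- An as-maximal element: an element of an as-component. -/
def IsAsMaxElem {σ : Signature} (𝒦 : Set (UAlgebra σ)) (A : UAlgebra σ)
    (a : A.carrier) : Prop :=
  ∀ b, asReach 𝒦 A a b → asReach 𝒦 A b a

/-- An as-component of `A`: a maximal strongly connected component of `Gas(A)`. -/
def IsAsComponent {σ : Signature} (𝒦 : Set (UAlgebra σ)) (A : UAlgebra σ)
    (C : Set A.carrier) : Prop :=
  ∃ a, IsAsMaxElem 𝒦 A a ∧ C = {b | asReach 𝒦 A a b ∧ asReach 𝒦 A b a}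

namespace UAlgebra

variable {σ : Signature}

/-- Binary direct product. -/
def prod (A B : UAlgebra σ) : UAlgebra σ where
  carrier := A.carrier × B.carrier
  interp f x := (A.interp f fun j => (x j).1, B.interp f fun j => (x j).2)

/-- Direct product of a family. -/
def pi {ι : Type} (A : ι → UAlgebra σ) : UAlgebra σ where
  carrier := ∀ i, (A i).carrier
  interp f x := fun i => (A i).interp f fun j => x j i

/-- Homomorphism of similar algebras. -/
def IsHom (A B : UAlgebra σ) (φ : A.carrier → B.carrier) : Prop :=
  ∀ (f : σ.ops) (x : Fin (σ.arity f) → A.carrier),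
    φ (A.interp f x) = B.interp f fun j => φ (x j)

/-- Simple algebra: only the equality and full congruences. -/
def IsSimple (A : UAlgebra σ) : Prop :=
  ∀ θ : Congruence A, (∀ x y, θ.rel x y ↔ x = y) ∨ θ.IsFull

/-- Maximal generated algebra: generated by one of its maximal components. -/
def MaximalGenerated (A : UAlgebra σ) : Prop :=
  ∃ C : Set A.carrier, A.IsMaxComponent C ∧ A.ClosureSet C = Set.univ

/-- The number of subalgebras (nonempty closed subsets) of an algebra. -/
noncomputable def numSubalgebras (A : UAlgebra σ) : ℕ :=
  Nat.card {S : Set A.carrier // S.Nonempty ∧ A.IsClosed S}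

end UAlgebra

/-- A (k+3)-ary term is an edge term for a class `𝒦`. -/
def IsEdgeTermFor {σ : Signature} (𝒦 : Set (UAlgebra σ)) {k : ℕ}
    (t : Term σ (k + 3)) : Prop :=
  ∀ A ∈ 𝒦, ∀ x y : A.carrier,
    t.eval A (fun i => if i.val ≤ 1 then y else x) = x ∧
    t.eval A (fun i => if i.val = 0 ∨ i.val = 2 then y else x) = x ∧
    ∀ j : Fin (k + 3), 3 ≤ j.val →
      t.eval A (Function.update (fun _ => x) j y) = x

/-- A finite class has few subproducts. -/
def FewSubproducts {σ : Signature} (K : Set (UAlgebra σ)) : Prop :=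
  ∃ p : Polynomial ℕ, ∀ (n : ℕ) (A : Fin n → UAlgebra σ), (∀ i, A i ∈ K) →
    UAlgebra.numSubalgebras (UAlgebra.pi A) ≤ 2 ^ (p.eval n)

/-- `g_K` is bounded by a polynomial: every subalgebra of an `n`-fold product
of members of `K` has a generating set of polynomial size. -/
def PolyGenerated {σ : Signature} (K : Set (UAlgebra σ)) : Prop :=
  ∃ p : Polynomial ℕ, ∀ (n : ℕ) (A : Fin n → UAlgebra σ), (∀ i, A i ∈ K) →
    ∀ S : Set (UAlgebra.pi A).carrier, S.Nonempty → (UAlgebra.pi A).IsClosed S →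
      ∃ G : Set (UAlgebra.pi A).carrier, G ⊆ S ∧ G.Finite ∧
        G.ncard ≤ p.eval n ∧ (UAlgebra.pi A).ClosureSet G = S

/-! ### Terms and compatible relations -/

/-- Substitution of terms for the variables of a term. -/
def Term.bind {σ : Signature} {m n : ℕ} : Term σ n → (Fin n → Term σ m) → Term σ m
  | .var i, r => r i
  | .app f ts, r => .app f fun j => (ts j).bind r

theorem Term.eval_bind {σ : Signature} (A : UAlgebra σ) {m n : ℕ} (t : Term σ n)
    (r : Fin n → Term σ m) (x : Fin m → A.carrier) :
    (t.bind r).eval A x = t.eval A fun i => (r i).eval A x := by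
  induction t with
  | var i => rfl
  | app f ts ih => simp only [Term.bind, Term.eval, ih]

theorem Term.eval_bind_pair {σ : Signature} (A : UAlgebra σ) {m : ℕ} (t : Term σ 2)
    (r s : Term σ m) (x : Fin m → A.carrier) :
    (t.bind ![r, s]).eval A x = t.eval A ![r.eval A x, s.eval A x] := by
  rw [Term.eval_bind]
  congr 1
  funext i
  fin_cases i <;> rfl

/-- Iteration of a binary term in its second variable. -/
def Term.iter {σ : Signature} (t : Term σ 2) : ℕ → Term σ 2
  | 0 => .var 1
  | n + 1 => t.bind ![.var 0, t.iter n]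

theorem Term.eval_iter {σ : Signature} (A : UAlgebra σ) (t : Term σ 2) (n : ℕ)
    (a b : A.carrier) :
    (t.iter n).eval A ![a, b] = (fun y => t.eval A ![a, y])^[n] b := by
  induction n with
  | zero => rfl
  | succ n ih =>
    rw [Term.iter, Term.eval_bind_pair, ih, Function.iterate_succ_apply']
    rfl

/-- Some positive iterate of a self-map of a finite type is idempotent. -/
theorem exists_iterate_idempotent {α : Type*} [Finite α] (g : α → α) :
    ∃ N : ℕ, 0 < N ∧ ∀ y, g^[N] (g^[N] y) = g^[N] y := by
  obtain ⟨m, m', hlt, he⟩ : ∃ m m' : ℕ, m < m' ∧ g^[m] = g^[m'] := by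
    obtain ⟨m, m', hne, he⟩ := Finite.exists_ne_map_eq_of_infinite fun n : ℕ => g^[n]
    rcases lt_or_gt_of_ne hne with h | h
    · exact ⟨m, m', h, he⟩
    · exact ⟨m', m, h, he.symm⟩
  obtain ⟨p, rfl⟩ := Nat.exists_eq_add_of_lt hlt
  have hstep : ∀ k, g^[m + k + (p + 1)] = g^[m + k] := by
    intro k
    rw [show m + k + (p + 1) = k + (m + p + 1) by omega, Function.iterate_add, ← he,
      ← Function.iterate_add, add_comm]
  have hmul : ∀ j k, g^[m + k + (p + 1) * j] = g^[m + k] := by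
    intro j
    induction j with
    | zero => intro k; simp
    | succ j ih =>
      intro k
      rw [show m + k + (p + 1) * (j + 1) = m + (k + (p + 1) * j) + (p + 1) by ring, hstep,
        ← add_assoc, ih]
  refine ⟨(p + 1) * (m + 1), by positivity, fun y => ?_⟩
  obtain ⟨k, hk⟩ : ∃ k, (p + 1) * (m + 1) = m + k :=
    ⟨(p + 1) * (m + 1) - m, by have : m ≤ (p + 1) * (m + 1) := by nlinarith
                               omega⟩
  rw [← Function.iterate_add_apply]
  have := hmul (m + 1) k
  rw [← hk] at this
  rw [this]

namespace UAlgebra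

variable {σ : Signature}

theorem IsClosed.eval_mem {A : UAlgebra σ} {S : Set A.carrier} (hS : A.IsClosed S) {n : ℕ}
    (t : Term σ n) {x : Fin n → A.carrier} (hx : ∀ i, x i ∈ S) : t.eval A x ∈ S := by
  induction t with
  | var i => exact hx i
  | app f ts ih => exact hS f _ ih

theorem closureSet_subset {A : UAlgebra σ} {S T : Set A.carrier} (hT : A.IsClosed T)
    (h : S ⊆ T) : A.ClosureSet S ⊆ T := by
  intro x hx
  induction hx with
  | base ha => exact h ha
  | app f x _ ih => exact hT f x ih

theorem exists_term_of_mem_closureSet {A : UAlgebra σ} {a b x : A.carrier}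
    (hx : x ∈ A.ClosureSet {a, b}) : ∃ r : Term σ 2, r.eval A ![a, b] = x := by
  induction hx with
  | @base x hx =>
    rcases hx with rfl | hx
    · exact ⟨.var 0, rfl⟩
    · exact ⟨.var 1, hx.symm⟩
  | app f x _ ih =>
    choose r hr using ih
    exact ⟨.app f r, by simp [Term.eval, hr]⟩

/-- A set of `J`-tuples over `A` is compatible if it is closed under the basic operations
acting coordinatewise. -/
def Compatible (A : UAlgebra σ) {J : Type} (R : Set (J → A.carrier)) : Prop :=
  ∀ (f : σ.ops) (x : Fin (σ.arity f) → J → A.carrier), (∀ k, x k ∈ R) →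
    (fun j => A.interp f fun k => x k j) ∈ R

theorem Compatible.eval_mem {A : UAlgebra σ} {J : Type} {R : Set (J → A.carrier)}
    (hR : A.Compatible R) {n : ℕ} (t : Term σ n) {x : Fin n → J → A.carrier}
    (hx : ∀ i, x i ∈ R) : (fun j => t.eval A fun i => x i j) ∈ R := by
  induction t with
  | var i => exact hx i
  | app f ts ih => exact hR f _ ih

/-- The compatible relation generated by a set of tuples. -/
def relSg (A : UAlgebra σ) {J : Type} (G : Set (J → A.carrier)) : Set (J → A.carrier) :=
  {z | ∀ R, A.Compatible R → G ⊆ R → z ∈ R}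

theorem subset_relSg (A : UAlgebra σ) {J : Type} (G : Set (J → A.carrier)) :
    G ⊆ A.relSg G := fun _ hz _ _ hG => hG hz

theorem compatible_relSg (A : UAlgebra σ) {J : Type} (G : Set (J → A.carrier)) :
    A.Compatible (A.relSg G) :=
  fun f x hx R hR hG => hR f x fun k => hx k R hR hG

theorem relSg_subset {A : UAlgebra σ} {J : Type} {G R : Set (J → A.carrier)}
    (hR : A.Compatible R) (hG : G ⊆ R) : A.relSg G ⊆ R := fun _ hz => hz R hR hG

/-! ### Cube term blockers -/

/-- `(C, D)` is a cube term blocker of `A`. -/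
structure IsBlocker (A : UAlgebra σ) (C D : Set A.carrier) : Prop where
  subset : C ⊆ D
  nonempty : C.Nonempty
  exists_notMem : ∃ d ∈ D, d ∉ C
  closed : A.IsClosed D
  compatible : ∀ (I : Type) [Finite I],
    A.Compatible {x : I → A.carrier | (∀ i, x i ∈ D) ∧ ∃ i, x i ∈ C}

theorem IsBlocker.inter {A : UAlgebra σ} {C D E : Set A.carrier} (h : A.IsBlocker C D)
    (hE : A.IsClosed E) (hED : E ⊆ D) (hC : ∃ c ∈ E, c ∈ C) (hD : ∃ d ∈ E, d ∉ C) :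
    A.IsBlocker (C ∩ E) E where
  subset := Set.inter_subset_right
  nonempty := by
    obtain ⟨c, hcE, hcC⟩ := hC
    exact ⟨c, hcC, hcE⟩
  exists_notMem := by
    obtain ⟨d, hdE, hdC⟩ := hD
    exact ⟨d, hdE, fun h => hdC h.1⟩
  closed := hE
  compatible := fun I _ f x hx => by
    have hmem : ∀ i, A.interp f (fun k => x k i) ∈ E := fun i => hE f _ fun k => (hx k).1 i
    obtain ⟨-, i, hi⟩ := h.compatible I f x fun k =>
      ⟨fun i => hED ((hx k).1 i), (hx k).2.imp fun _ hi => hi.1⟩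
    exact ⟨hmem, i, hi, hmem i⟩

/-- The term `t` takes values in `C` on tuples over `D` whose `i`-th entry is in `C`. -/
def Absorbs (A : UAlgebra σ) (C D : Set A.carrier) {n : ℕ} (t : Term σ n) (i : Fin n) : Prop :=
  ∀ x : Fin n → A.carrier, (∀ j, x j ∈ D) → x i ∈ C → t.eval A x ∈ C

theorem IsBlocker.exists_absorbs {A : UAlgebra σ} {C D : Set A.carrier}
    (h : A.IsBlocker C D) {n : ℕ} (t : Term σ n) : ∃ i, A.Absorbs C D t i := by
  by_contra hno
  simp only [Absorbs, not_exists, not_forall] at hno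
  choose x hxD hxC hx using hno
  obtain ⟨-, i, hi⟩ := (h.compatible (Fin n)).eval_mem t (x := fun j i => x i j)
    fun j => ⟨fun i => hxD i j, j, hxC j⟩
  exact hx i hi

theorem Absorbs.bind {A : UAlgebra σ} {C D : Set A.carrier} (hD : A.IsClosed D) {m n : ℕ}
    {t : Term σ n} {i : Fin n} {r : Fin n → Term σ m} {j : Fin m} (ht : A.Absorbs C D t i)
    (hr : A.Absorbs C D (r i) j) : A.Absorbs C D (t.bind r) j := by
  intro x hx hj
  rw [Term.eval_bind]
  exact ht _ (fun k => hD.eval_mem _ hx) (hr x hx hj)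

theorem absorbs_var (A : UAlgebra σ) (C D : Set A.carrier) {n : ℕ} (i : Fin n) :
    A.Absorbs C D (.var i : Term σ n) i := fun _ _ h => h

theorem Absorbs.eval_left {A : UAlgebra σ} {C D : Set A.carrier} {t : Term σ 2}
    (h : A.Absorbs C D t 0) (hCD : C ⊆ D) {c d : A.carrier} (hc : c ∈ C) (hd : d ∈ D) :
    t.eval A ![c, d] ∈ C := by
  refine h _ (fun j => ?_) hc
  fin_cases j
  exacts [hCD hc, hd]

theorem Absorbs.eval_right {A : UAlgebra σ} {C D : Set A.carrier} {t : Term σ 2}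
    (h : A.Absorbs C D t 1) (hCD : C ⊆ D) {c d : A.carrier} (hc : c ∈ C) (hd : d ∈ D) :
    t.eval A ![d, c] ∈ C := by
  refine h _ (fun j => ?_) hc
  fin_cases j
  exacts [hd, hCD hc]

theorem Idempotent.eval_const {A : UAlgebra σ} (hid : A.Idempotent) {n : ℕ} (t : Term σ n)
    (a : A.carrier) : t.eval A (fun _ => a) = a := by
  induction t with
  | var i => rfl
  | app f ts ih => simp only [Term.eval, ih, hid f a]

theorem Idempotent.eval_pair {A : UAlgebra σ} (hid : A.Idempotent) (t : Term σ 2)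
    (a : A.carrier) : t.eval A ![a, a] = a := by
  convert hid.eval_const t a using 2
  funext i
  fin_cases i <;> rfl

/-- Some binary term operation acts on `{a, b}` as a semilattice operation with least
element `b`. -/
def IsStrongThinEdge (A : UAlgebra σ) (a b : A.carrier) : Prop :=
  a ≠ b ∧ ∃ t : Term σ 2, t.eval A ![a, b] = b ∧ t.eval A ![b, a] = b

/-- A binary term absorbing a subset in both variables yields a semilattice pair. -/
theorem exists_isStrongThinEdge_of_absorbs {A : UAlgebra σ} [Finite A.carrier]
    (hid : A.Idempotent) {C D : Set A.carrier} (hCD : C ⊆ D)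
    {c d : A.carrier} (hc : c ∈ C) (hd : d ∈ D) (hdC : d ∉ C) {t : Term σ 2}
    (h0 : A.Absorbs C D t 0) (h1 : A.Absorbs C D t 1) :
    ∃ a b, A.IsStrongThinEdge a b := by
  obtain ⟨N, hN, hNid⟩ := exists_iterate_idempotent fun y => t.eval A ![d, y]
  obtain ⟨N, rfl⟩ := Nat.exists_eq_succ_of_ne_zero hN.ne'
  set u := t.iter (N + 1) with hu
  have hueval := Term.eval_iter A t (N + 1)
  rw [← hu] at hueval
  have hud : ∀ y, u.eval A ![d, u.eval A ![d, y]] = u.eval A ![d, y] := by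
    intro y; rw [hueval, hueval]; exact hNid y
  have huC : ∀ c ∈ C, ∀ n, (t.iter n).eval A ![d, c] ∈ C := by
    intro c hc n
    rw [Term.eval_iter]
    induction n with
    | zero => exact hc
    | succ n ih =>
      rw [Function.iterate_succ_apply']
      exact h1.eval_right hCD ih hd
  have huCd : ∀ c ∈ C, ∀ n, (t.iter (n + 1)).eval A ![c, d] ∈ C := by
    intro c hc n
    rw [Term.eval_iter]
    induction n with
    | zero => exact h0.eval_left hCD hc hd
    | succ n ih =>
      rw [Function.iterate_succ_apply']
      exact h0.eval_left hCD hc (hCD ih)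
  set v : Term σ 2 := u.bind ![.var 0, u.bind ![.var 1, .var 0]] with hv
  have hveval : ∀ x y, v.eval A ![x, y] = u.eval A ![x, u.eval A ![y, x]] := by
    intro x y
    rw [hv, Term.eval_bind_pair, Term.eval_bind_pair]
    rfl
  obtain ⟨M, hM, hMid⟩ := exists_iterate_idempotent fun y => v.eval A ![d, y]
  have hvfix : ∀ y, u.eval A ![d, v.eval A ![d, y]] = v.eval A ![d, y] := by
    intro y; rw [hveval, hud]
  have hvC : ∀ c ∈ C, v.eval A ![d, c] ∈ C := by
    intro c hc
    rw [hveval]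
    exact huC _ (huCd c hc N) _
  set e := (fun y => v.eval A ![d, y])^[M] c with he
  have heC : ∀ n, (fun y => v.eval A ![d, y])^[n] c ∈ C := by
    intro n
    induction n with
    | zero => exact hc
    | succ n ih =>
      rw [Function.iterate_succ_apply']
      exact hvC _ ih
  have hefix : u.eval A ![d, e] = e := by
    obtain ⟨M, rfl⟩ := Nat.exists_eq_succ_of_ne_zero hM.ne'
    rw [he, Function.iterate_succ_apply']
    exact hvfix _
  have hed : v.eval A ![e, d] = e := by
    rw [hveval, hefix, hid.eval_pair]
  refine ⟨d, e, fun h => hdC (h ▸ heC M), v.iter M, ?_, ?_⟩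
  · rw [Term.eval_iter, he, hMid]
  · rw [Term.eval_iter]
    obtain ⟨M', rfl⟩ := Nat.exists_eq_succ_of_ne_zero hM.ne'
    rw [Function.iterate_succ_apply, hed]
    exact Function.iterate_fixed (hid.eval_pair v e) M'

end UAlgebra

namespace UAlgebra

variable {σ : Signature}

/-! ### Minimal blockers yield edges of the unary type -/

theorem IsBlocker.eval_notMem {A : UAlgebra σ} [Finite A.carrier] {C D : Set A.carrier}
    (h : A.IsBlocker C D) (hgen : ∀ c ∈ C, ∀ d ∈ D, d ∉ C → D ⊆ A.ClosureSet {c, d})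
    (hno : ∀ t : Term σ 2, A.Absorbs C D t 0 → ¬ A.Absorbs C D t 1) {f : Term σ 2}
    (hf : A.Absorbs C D f 0) {c d : A.carrier} (hc : c ∈ C) (hd : d ∈ D) (hdC : d ∉ C) :
    f.eval A ![d, c] ∉ C := by
  intro hfC
  have hpairD : ∀ {x y : A.carrier}, x ∈ D → y ∈ D → ∀ i : Fin 2, (![x, y] : Fin 2 → _) i ∈ D := by
    intro x y hx hy i
    fin_cases i
    exacts [hx, hy]
  have hpair : ∀ e ∈ D, ∀ c' ∈ C, ∃ f' : Term σ 2,
      A.Absorbs C D f' 0 ∧ f'.eval A ![e, c'] ∈ C := by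
    intro e he c' hc'
    by_cases heC : e ∈ C
    · exact ⟨.var 0, A.absorbs_var C D 0, heC⟩
    have hD := hgen c' hc' e he heC
    rw [Set.pair_comm] at hD
    obtain ⟨r₁, hr₁⟩ := exists_term_of_mem_closureSet (hD hd)
    obtain ⟨r₂, hr₂⟩ := exists_term_of_mem_closureSet (hD (h.subset hc))
    obtain ⟨i, hi⟩ := h.exists_absorbs r₁
    have hi0 : A.Absorbs C D r₁ 0 := by
      fin_cases i
      · exact hi
      · exact absurd (hr₁ ▸ hi.eval_right h.subset hc' he) hdC
    refine ⟨f.bind ![r₁, r₂], hf.bind h.closed hi0, ?_⟩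
    rwa [Term.eval_bind_pair, hr₁, hr₂]
  have hall : ∀ Z : Finset (A.carrier × A.carrier), (∀ z ∈ Z, z.1 ∈ D ∧ z.2 ∈ C) →
      ∃ F : Term σ 2, A.Absorbs C D F 0 ∧ ∀ z ∈ Z, F.eval A ![z.1, z.2] ∈ C := by
    classical
    intro Z
    induction Z using Finset.induction_on with
    | empty => exact fun _ => ⟨.var 0, A.absorbs_var C D 0, by simp⟩
    | insert z Z _ ih =>
      intro hZ
      obtain ⟨F, hF, hFZ⟩ := ih fun z hz => hZ z (Finset.mem_insert_of_mem hz)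
      have hz := hZ z (Finset.mem_insert_self _ _)
      have he : F.eval A ![z.1, z.2] ∈ D :=
        h.closed.eval_mem F (hpairD hz.1 (h.subset hz.2))
      obtain ⟨f', hf', hf'z⟩ := hpair _ he _ hz.2
      refine ⟨f'.bind ![F, .var 1], hf'.bind h.closed hF, fun w hw => ?_⟩
      rw [Term.eval_bind_pair]
      rcases Finset.mem_insert.1 hw with rfl | hw'
      · exact hf'z
      · exact hf'.eval_left h.subset (hFZ w hw') (h.subset (hZ w hw).2)
  obtain ⟨F, hF, hFZ⟩ := hall (Set.toFinite {z : A.carrier × A.carrier |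
    z.1 ∈ D ∧ z.2 ∈ C}).toFinset
    (by simp)
  refine hno F hF fun x hx hx1 => ?_
  have := hFZ (x 0, x 1) (by simp [hx 0, hx1])
  convert this using 2
  funext i
  fin_cases i <;> rfl

theorem IsBlocker.eval_mem_iff {A : UAlgebra σ} [Finite A.carrier] {C D : Set A.carrier}
    (h : A.IsBlocker C D) (hgen : ∀ c ∈ C, ∀ d ∈ D, d ∉ C → D ⊆ A.ClosureSet {c, d})
    (hno : ∀ t : Term σ 2, A.Absorbs C D t 0 → ¬ A.Absorbs C D t 1) {n : ℕ} {t : Term σ n}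
    {i : Fin n} (ht : A.Absorbs C D t i) {x : Fin n → A.carrier} (hx : ∀ j, x j ∈ D) :
    t.eval A x ∈ C ↔ x i ∈ C := by
  refine ⟨fun htx => by_contra fun hi => ?_, ht x hx⟩
  obtain ⟨c, hc⟩ := h.nonempty
  have hD := hgen c hc _ (hx i) hi
  rw [Set.pair_comm] at hD
  have hr : ∀ j, ∃ r : Term σ 2, r.eval A ![x i, c] = x j ∧ (j = i → A.Absorbs C D r 0) := by
    intro j
    by_cases hj : j = i
    · exact ⟨.var 0, by simp [Term.eval, hj], fun _ => A.absorbs_var C D 0⟩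
    · obtain ⟨r, hr⟩ := exists_term_of_mem_closureSet (hD (hx j))
      exact ⟨r, hr, fun h => absurd h hj⟩
  choose r hr hri using hr
  refine h.eval_notMem hgen hno (ht.bind h.closed (hri i rfl)) hc (hx i) hi ?_
  rw [Term.eval_bind]
  simpa only [hr] using htx

theorem subalg_eval_coe (A : UAlgebra σ) (S : Set A.carrier) (hS : A.IsClosed S) {n : ℕ}
    (t : Term σ n) (x : Fin n → (A.subalg S hS).carrier) :
    (t.eval (A.subalg S hS) x).1 = t.eval A fun i => (x i).1 := by
  induction t with
  | var i => rfl
  | app f ts ih => simp only [Term.eval, ← ih]; rfl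

theorem Congruence.eval_rel {A : UAlgebra σ} (θ : Congruence A) {n : ℕ} (t : Term σ n)
    {x y : Fin n → A.carrier} (h : ∀ i, θ.rel (x i) (y i)) :
    θ.rel (t.eval A x) (t.eval A y) := by
  induction t with
  | var i => exact h i
  | app f ts ih => exact θ.compat f _ _ ih

theorem quot_eval_mk (A : UAlgebra σ) (θ : Congruence A) {n : ℕ} (t : Term σ n)
    (x : Fin n → A.carrier) :
    t.eval (A.quot θ) (fun i => Quotient.mk θ.toSetoid (x i)) =
      Quotient.mk θ.toSetoid (t.eval A x) := by
  induction t with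
  | var i => rfl
  | app f ts ih =>
    simp only [Term.eval, ih]
    exact Quotient.sound (θ.compat f _ _ fun j =>
      Quotient.exact (Quotient.out_eq (Quotient.mk θ.toSetoid ((ts j).eval A x))))

theorem IsBlocker.isUnaryEdge {A : UAlgebra σ} [Finite A.carrier] {C D : Set A.carrier}
    (h : A.IsBlocker C D) (hgen : ∀ c ∈ C, ∀ d ∈ D, d ∉ C → D ⊆ A.ClosureSet {c, d})
    (hno : ∀ t : Term σ 2, A.Absorbs C D t 0 → ¬ A.Absorbs C D t 1) {c d : A.carrier}
    (hc : c ∈ C) (hd : d ∈ D) (hdC : d ∉ C) : A.IsUnaryEdge c d := by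
  have hsub : A.ClosureSet {c, d} ⊆ D := closureSet_subset h.closed (by
    rintro x (rfl | rfl)
    exacts [h.subset hc, hd])
  have heval : ∀ {n : ℕ} (t : Term σ n), ∃ i, ∀ x : Fin n → (A.Sg {c, d}).carrier,
      (t.eval (A.Sg {c, d}) x).1 ∈ C ↔ (x i).1 ∈ C := by
    intro n t
    obtain ⟨i, hi⟩ := h.exists_absorbs t
    refine ⟨i, fun x => ?_⟩
    exact (Iff.of_eq (congrArg (· ∈ C) (A.subalg_eval_coe _ _ t x))).trans
      (h.eval_mem_iff hgen hno hi fun j => hsub (x j).2)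
  let θ : Congruence (A.Sg {c, d}) :=
    { rel := fun x y => x.1 ∈ C ↔ y.1 ∈ C
      refl := fun _ => Iff.rfl
      symm := Iff.symm
      trans := Iff.trans
      compat := fun f x y hxy => by
        obtain ⟨i, hi⟩ := heval (.app f .var)
        exact (hi x).trans ((hxy i).trans (hi y).symm) }
  refine ⟨fun e => hdC (e ▸ hc), θ, ⟨fun hfull => ?_, fun η hle hη x y hxy => ?_⟩, ?_⟩
  · exact hdC ((hfull (A.sgA c d) (A.sgB c d)).1 hc)
  · by_contra hne
    refine hη fun u v => ?_
    have key : ∀ w, η.rel w x ∨ η.rel w y := by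
      intro w
      by_cases hw : w.1 ∈ C ↔ x.1 ∈ C
      · exact .inl (hle _ _ hw)
      · refine .inr (hle _ _ ?_)
        change w.1 ∈ C ↔ y.1 ∈ C
        have : ¬ (x.1 ∈ C ↔ y.1 ∈ C) := hne
        tauto
    have key' : ∀ w, η.rel w x := fun w => (key w).elim id fun hw => η.trans hw (η.symm hxy)
    exact η.trans (key' u) (η.symm (key' v))
  · intro n t
    obtain ⟨i, hi⟩ := heval t
    refine ⟨i, fun x => ?_⟩
    have hx : x = fun i => Quotient.mk θ.toSetoid (x i).out :=
      funext fun i => (Quotient.out_eq (x i)).symm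
    rw [hx, quot_eval_mk]
    exact Quotient.sound (hi _)

theorem IsBlocker.exists_edge {A : UAlgebra σ} [Finite A.carrier] (hid : A.Idempotent)
    {C D : Set A.carrier} (h : A.IsBlocker C D) :
    (∃ a b, A.IsStrongThinEdge a b) ∨ ∃ a b, A.IsUnaryEdge a b := by
  obtain ⟨⟨C, D⟩, h, hmin⟩ := exists_minimalFor_of_wellFoundedLT
    (fun p : Set A.carrier × Set A.carrier => A.IsBlocker p.1 p.2) (fun p => p.2) ⟨(C, D), h⟩
  simp only at h hmin
  by_cases hs : ∃ a b, A.IsStrongThinEdge a b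
  · exact .inl hs
  obtain ⟨c, hc⟩ := h.nonempty
  obtain ⟨d, hd, hdC⟩ := h.exists_notMem
  refine .inr ⟨c, d, h.isUnaryEdge (fun c hc d hd hdC => ?_) (fun t h0 h1 => hs ?_) hc hd hdC⟩
  · have hsub : A.ClosureSet {c, d} ⊆ D := closureSet_subset h.closed (by
      rintro x (rfl | rfl)
      exacts [h.subset hc, hd])
    exact hmin (j := (C ∩ A.ClosureSet {c, d}, A.ClosureSet {c, d}))
      (h.inter (A.closureSet_isClosed _) hsub
        ⟨c, Closure.base (by simp), hc⟩ ⟨d, Closure.base (by simp), hdC⟩) hsub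
  · exact exists_isStrongThinEdge_of_absorbs hid h.subset hc hd hdC h0 h1

theorem Idempotent.subalg {A : UAlgebra σ} (hid : A.Idempotent) (S : Set A.carrier)
    (hS : A.IsClosed S) : (A.subalg S hS).Idempotent :=
  fun f a => Subtype.ext (hid f a.1)

theorem OmitsType1.not_isBlocker {A : UAlgebra σ} [Finite A.carrier] (hid : A.Idempotent)
    (h1 : A.OmitsType1) (hs : ∀ a b, ¬ A.IsStrongThinEdge a b) (C D : Set A.carrier) :
    ¬ A.IsBlocker C D := by
  intro h
  have hU : A.IsClosed Set.univ := fun _ _ _ => trivial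
  set B := A.subalg Set.univ hU with hB
  have : Finite B.carrier := Subtype.finite
  have hBl : B.IsBlocker {x | x.1 ∈ C} {x | x.1 ∈ D} :=
    { subset := fun x hx => h.subset hx
      nonempty := by
        obtain ⟨c, hc⟩ := h.nonempty
        exact ⟨⟨c, trivial⟩, hc⟩
      exists_notMem := by
        obtain ⟨d, hd, hdC⟩ := h.exists_notMem
        exact ⟨⟨d, trivial⟩, hd, hdC⟩
      closed := fun f x hx => h.closed f _ hx
      compatible := fun I _ f x hx => h.compatible I f (fun k i => (x k i).1) hx }
  rcases hBl.exists_edge (hid.subalg _ hU) with ⟨a, b, hab, t, ht, ht'⟩ | ⟨a, b, hab⟩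
  · refine hs a.1 b.1 ⟨fun e => hab (Subtype.ext e), t, ?_, ?_⟩
    · have := congrArg Subtype.val ht
      rw [subalg_eval_coe] at this
      convert this using 2
      funext i
      fin_cases i <;> rfl
    · have := congrArg Subtype.val ht'
      rw [subalg_eval_coe] at this
      convert this using 2
      funext i
      fin_cases i <;> rfl
  · exact h1 _ hU a b hab

end UAlgebra

namespace UAlgebra

variable {σ : Signature}

/-! ### Absence of semilattice pairs -/

theorem isSemilatticeOn_pair {α : Type} {f : α → α → α} {p q : α} (hp : f p p = p)
    (hq : f q q = q) (hpq : f p q = q) (hqp : f q p = q) : IsSemilatticeOn f {p, q} := by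
  refine ⟨?_, ?_, ?_⟩
  · rintro x (rfl | rfl) <;> assumption
  · rintro x (rfl | rfl) y (rfl | rfl) <;> simp only [hpq, hqp]
  · rintro x (rfl | rfl) y (rfl | rfl) z (rfl | rfl) <;> simp only [hp, hq, hpq, hqp]

theorem Idempotent.quot {A : UAlgebra σ} (hid : A.Idempotent) (θ : Congruence A) :
    (A.quot θ).Idempotent := fun f a =>
  (congrArg (Quotient.mk θ.toSetoid) (hid f a.out)).trans (Quotient.out_eq a)

theorem Sg_eval_pair {A : UAlgebra σ} {a b : A.carrier} (t : Term σ 2)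
    (x y : (A.Sg {a, b}).carrier) :
    (t.eval (A.Sg {a, b}) ![x, y]).1 = t.eval A ![x.1, y.1] := by
  refine (A.subalg_eval_coe _ _ t ![x, y]).trans ?_
  congr 1
  funext i
  fin_cases i <;> rfl

theorem Sg_quot_eval_pair {A : UAlgebra σ} {a b : A.carrier} (θ : Congruence (A.Sg {a, b}))
    (t : Term σ 2) (x y : (A.Sg {a, b}).carrier) :
    t.eval ((A.Sg {a, b}).quot θ)
        ![Quotient.mk θ.toSetoid x, Quotient.mk θ.toSetoid y] =
      Quotient.mk θ.toSetoid (t.eval (A.Sg {a, b}) ![x, y]) := by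
  rw [← quot_eval_mk]
  congr 1
  funext i
  fin_cases i <;> rfl

theorem Congruence.isFull_of_rel {A : UAlgebra σ} (hid : A.Idempotent) {a b : A.carrier}
    (θ : Congruence (A.Sg {a, b})) (h : θ.rel (A.sgA a b) (A.sgB a b)) : θ.IsFull := by
  have key : ∀ x, θ.rel x (A.sgA a b) := by
    intro x
    obtain ⟨r, hr⟩ := exists_term_of_mem_closureSet x.2
    have hx : x = r.eval (A.Sg {a, b}) ![A.sgA a b, A.sgB a b] :=
      Subtype.ext (hr.symm.trans (Sg_eval_pair r (A.sgA a b) (A.sgB a b)).symm)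
    have ha : A.sgA a b = r.eval (A.Sg {a, b}) ![A.sgA a b, A.sgA a b] :=
      ((hid.subalg _ _).eval_pair r (A.sgA a b)).symm
    rw [hx]
    nth_rewrite 2 [ha]
    refine θ.eval_rel r fun i => ?_
    fin_cases i
    exacts [θ.refl _, θ.symm h]
  exact fun x y => θ.trans (key x) (θ.symm (key y))

theorem eq_of_add_smul_swap {R M : Type*} [Ring R] [AddCommGroup M] [Module R M] {r s : R}
    (h : r + s = 1) {x y : M} (hxy : y = r • x + s • y) (hyx : y = r • y + s • x) : x = y := by
  have : x + y = y + y := by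
    calc x + y = (r + s) • x + (r + s) • y := by rw [h, one_smul, one_smul]
      _ = (r • x + s • y) + (r • y + s • x) := by rw [add_smul, add_smul]; abel
      _ = y + y := by rw [← hxy, ← hyx]
  exact add_right_cancel this

theorem not_isStrongThinEdge {A : UAlgebra σ} (hid : A.Idempotent)
    (hedge : ∀ a b : A.carrier, A.IsEdge a b → A.IsMajEdge a b ∨ A.IsAffEdge a b)
    (a b : A.carrier) : ¬ A.IsStrongThinEdge a b := by
  rintro ⟨hab, t, hab', hba'⟩
  have hqab : ∀ θ : Congruence (A.Sg {a, b}),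
      t.eval ((A.Sg {a, b}).quot θ) ![A.qa a b θ, A.qb a b θ] = A.qb a b θ := fun θ =>
    (Sg_quot_eval_pair θ t _ _).trans (congrArg (Quotient.mk θ.toSetoid)
      (Subtype.ext ((Sg_eval_pair t _ _).trans hab')))
  have hqba : ∀ θ : Congruence (A.Sg {a, b}),
      t.eval ((A.Sg {a, b}).quot θ) ![A.qb a b θ, A.qa a b θ] = A.qb a b θ := fun θ =>
    (Sg_quot_eval_pair θ t _ _).trans (congrArg (Quotient.mk θ.toSetoid)
      (Subtype.ext ((Sg_eval_pair t _ _).trans hba')))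
  have hSL : ∀ θ : Congruence (A.Sg {a, b}), IsSemilatticeOn
      (fun x y => t.eval ((A.Sg {a, b}).quot θ) ![x, y]) {A.qa a b θ, A.qb a b θ} := fun θ =>
    isSemilatticeOn_pair (((hid.subalg _ _).quot θ).eval_pair t _)
      (((hid.subalg _ _).quot θ).eval_pair t _) (hqab θ) (hqba θ)
  have hIsEdge : A.IsEdge a b := by
    let θ : Congruence (A.Sg {a, b}) :=
      { rel := fun x y => x = y
        refl := fun _ => rfl
        symm := Eq.symm
        trans := Eq.trans
        compat := fun f x y h => congrArg _ (funext h) }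
    exact ⟨hab, θ, fun hf => hab (congrArg Subtype.val (hf (A.sgA a b) (A.sgB a b))),
      .inr (.inr (.inl ⟨t, hSL θ⟩))⟩
  rcases hedge a b hIsEdge with ⟨-, θ, -, -, hno⟩ | ⟨-, θ, hmax, R, _, _, _, _, hterm, -⟩
  · exact hno ⟨t, hSL θ⟩
  · obtain ⟨c, hc, hx⟩ := (hterm 2 fun x => t.eval _ x).1 ⟨t, fun _ => rfl⟩
    have e1 := hx ![A.qa a b θ, A.qb a b θ]
    have e2 := hx ![A.qb a b θ, A.qa a b θ]
    simp only [hqab, hqba, Fin.sum_univ_two, Matrix.cons_val_zero, Matrix.cons_val_one] at e1 e2 hc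
    have e : A.qa a b θ = A.qb a b θ := eq_of_add_smul_swap hc e1 e2
    exact hmax.1 (θ.isFull_of_rel hid (Quotient.exact e))

end UAlgebra

namespace UAlgebra

variable {σ : Signature}

/-! ### Algebras without blockers -/

theorem Idempotent.pi {A : UAlgebra σ} (hid : A.Idempotent) (P : Type) :
    (UAlgebra.pi fun _ : P => A).Idempotent := fun f _ => funext fun _ => hid f _

theorem not_isBlocker_pi {A : UAlgebra σ} [Finite A.carrier] (hid : A.Idempotent)
    (hno : ∀ C D, ¬ A.IsBlocker C D) {P : Type} [Finite P]
    (C D : Set (UAlgebra.pi fun _ : P => A).carrier) :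
    ¬ (UAlgebra.pi fun _ : P => A).IsBlocker C D := by
  intro h
  have : Finite (UAlgebra.pi fun _ : P => A).carrier :=
    inferInstanceAs (Finite (P → A.carrier))
  obtain ⟨⟨C, D⟩, h, hmin⟩ := exists_minimalFor_of_wellFoundedLT
    (fun p : Set (UAlgebra.pi fun _ : P => A).carrier × Set (UAlgebra.pi fun _ : P => A).carrier =>
      (UAlgebra.pi fun _ : P => A).IsBlocker p.1 p.2) (fun p => p.2) ⟨(C, D), h⟩
  simp only at h hmin
  obtain ⟨c, hc⟩ := h.nonempty
  obtain ⟨d, hd, hdC⟩ := h.exists_notMem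
  obtain ⟨p, hp⟩ : ∃ p, c p ≠ d p := by
    by_contra! hcd
    exact hdC ((funext hcd : c = d) ▸ hc)
  have hsat : ∀ x ∈ D, ∀ y ∈ C, x p = y p → x ∈ C := by
    intro x hx y hy hxy
    by_contra hxC
    have hE : (UAlgebra.pi fun _ : P => A).IsClosed {z | z ∈ D ∧ z p = y p} := fun f z hz =>
      ⟨h.closed f z fun k => (hz k).1,
        (congrArg (A.interp f) (funext fun k => (hz k).2)).trans (hid f (y p))⟩
    have hle := hmin (j := (C ∩ {z | z ∈ D ∧ z p = y p}, {z | z ∈ D ∧ z p = y p}))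
      (h.inter hE (fun z hz => hz.1) ⟨y, ⟨h.subset hy, rfl⟩, hy⟩ ⟨x, ⟨hx, hxy⟩, hxC⟩)
      (fun z hz => hz.1)
    exact hp ((hle (h.subset hc)).2.trans (hle hd).2.symm)
  refine hno ((fun x => x p) '' C) ((fun x => x p) '' D) ⟨Set.image_mono h.subset, ⟨_, c, hc, rfl⟩,
    ⟨d p, ⟨d, hd, rfl⟩, ?_⟩, ?_, ?_⟩
  · rintro ⟨y, hy, hyd⟩
    exact hdC (hsat d hd y hy hyd.symm)
  · intro f x hx
    choose y hy hyx using hx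
    exact ⟨_, h.closed f y hy, congrArg (A.interp f) (funext hyx)⟩
  · intro I _ f x hx
    choose y hy hyx using fun k => (hx k).1
    obtain ⟨hD, i, hi⟩ := h.compatible I f y fun k => ⟨hy k, by
      obtain ⟨i, z, hz, hzx⟩ := (hx k).2
      exact ⟨i, hsat _ (hy k i) z hz ((hyx k i).trans hzx.symm)⟩⟩
    have e : ∀ i, A.interp f (fun k => y k i p) = A.interp f fun k => x k i := fun i =>
      congrArg (A.interp f) (funext fun k => hyx k i)
    exact ⟨fun i => ⟨_, hD i, e i⟩, i, _, hi, e i⟩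

theorem Compatible.preimage {A : UAlgebra σ} (hid : A.Idempotent) {J K : Type}
    {R : Set (K → A.carrier)} (hR : A.Compatible R) (φ : (J → A.carrier) → K → A.carrier)
    (hφ : ∀ k, (∃ j, ∀ x, φ x k = x j) ∨ ∃ c, ∀ x, φ x k = c) :
    A.Compatible {x | φ x ∈ R} := by
  intro f x hx
  have := hR f (fun k => φ (x k)) hx
  rw [Set.mem_ofPred_eq]
  convert this using 1
  funext k
  rcases hφ k with ⟨j, hj⟩ | ⟨c, hc⟩
  · simp only [hj]
  · simp only [hc, hid f c]

theorem IsClosed.of_compatible {A : UAlgebra σ} {S : Set A.carrier}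
    (hS : A.Compatible {x : Unit → A.carrier | x () ∈ S}) : A.IsClosed S :=
  fun f x hx => hS f (fun k _ => x k) hx

theorem exists_const_mem_relSg {F : UAlgebra σ} [Finite F.carrier] (hid : F.Idempotent)
    (hno : ∀ C D, ¬ F.IsBlocker C D) (a b : F.carrier) :
    ∃ (I : Type) (_ : Finite I), (fun _ => a) ∈
      F.relSg {x : I → F.carrier | (∀ i, x i = a ∨ x i = b) ∧ ∃ i, x i = b} := by
  classical
  by_contra hcon
  set D := F.ClosureSet {a, b} with hD
  have haD : a ∈ D := Closure.base (by simp)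
  have hbD : b ∈ D := Closure.base (by simp)
  let G : ∀ (C : Set F.carrier) (I : Type), Set (I → F.carrier) := fun C I =>
    {x | (∀ i, x i ∈ D) ∧ ∃ i, x i ∈ C}
  let Bad : Set F.carrier → Prop := fun C =>
    ∀ (I : Type) [Finite I], (fun _ => a) ∉ F.relSg (G C I)
  have hbad : Bad {b} := by
    intro I _ hmem
    refine hcon ⟨I, ‹_›, relSg_subset (F.compatible_relSg _) ?_ hmem⟩
    rintro x ⟨hxD, i₀, hi₀⟩
    have key : ∀ S : Finset I, i₀ ∉ S → ∀ x : I → F.carrier, (∀ i ∈ S, x i ∈ D) →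
        (∀ i, i ∉ S → x i = a ∨ x i = b) → x i₀ = b →
        x ∈ F.relSg {x : I → F.carrier | (∀ i, x i = a ∨ x i = b) ∧ ∃ i, x i = b} := by
      intro S
      induction S using Finset.induction_on with
      | empty => exact fun _ x _ hx hb => subset_relSg _ _ ⟨fun i => hx i (by simp), i₀, hb⟩
      | insert j S _ ih =>
        intro hi₀ x hxD hx hb
        simp only [Finset.mem_insert, not_or] at hi₀ hx
        have hcl : F.IsClosed {v | Function.update x j v ∈
            F.relSg {x : I → F.carrier | (∀ i, x i = a ∨ x i = b) ∧ ∃ i, x i = b}} :=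
          IsClosed.of_compatible ((F.compatible_relSg _).preimage hid
            (fun v => Function.update x j (v ())) fun k => by
              by_cases hk : k = j
              · subst hk; exact .inl ⟨(), fun v => by simp⟩
              · exact .inr ⟨x k, fun v => by simp [hk]⟩)
        have hgen : ∀ v, (v = a ∨ v = b) → Function.update x j v ∈
            F.relSg {x : I → F.carrier | (∀ i, x i = a ∨ x i = b) ∧ ∃ i, x i = b} := by
          intro v hv
          refine ih hi₀.2 _ (fun i hi => ?_) (fun i hi => ?_) ?_
          · by_cases hij : i = j
            · subst hij
              rcases hv with rfl | rfl <;> simpa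
            · simpa [hij] using hxD i (Finset.mem_insert_of_mem hi)
          · by_cases hij : i = j
            · subst hij
              simpa using hv
            · simpa [hij] using hx i ⟨hij, hi⟩
          · simpa [hi₀.1] using hb
        have := closureSet_subset hcl (S := {a, b}) (fun v hv => hgen v hv)
          (hxD j (Finset.mem_insert_self _ _))
        simpa using this
    have := Fintype.ofFinite I
    exact key (Finset.univ.erase i₀) (by simp) x (fun i _ => hxD i)
      (fun i hi => by
        have : i = i₀ := by simpa using hi
        exact .inr (this ▸ hi₀)) hi₀
  obtain ⟨C, ⟨hCD, hbC, hCbad⟩, hmax⟩ := exists_maximalFor_of_wellFoundedGT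
    (fun C : Set F.carrier => C ⊆ D ∧ b ∈ C ∧ Bad C) id
    ⟨{b}, by simpa using hbD, rfl, hbad⟩
  simp only [id] at hmax
  have haC : a ∉ C := fun haC => hCbad Unit (subset_relSg _ _ ⟨fun _ => haD, (), haC⟩)
  have hstep : ∀ n : ℕ, ∀ (K : Type) [Finite K] (w : K → F.carrier), w ∈ F.relSg (G C K) →
      (∀ k, w k = a ∨ w k ∈ D ∧ w k ∉ C) → {k | w k ≠ a}.ncard = n → False := by
    intro n
    induction n using Nat.strong_induction_on with
    | _ n ih =>
      intro K _ w hw hwk hn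
      by_cases hall : ∀ k, w k = a
      · exact hCbad K ((funext hall : w = fun _ => a) ▸ hw)
      push Not at hall
      obtain ⟨k₀, hk₀⟩ := hall
      obtain ⟨hvD, hvC⟩ := (hwk k₀).resolve_left hk₀
      have hnbad : ¬ Bad (insert (w k₀) C) := fun hB => hvC
        (hmax ⟨Set.insert_subset hvD hCD, Set.mem_insert_of_mem _ hbC, hB⟩
          (Set.subset_insert _ _) (Set.mem_insert _ _))
      simp only [Bad, not_forall, not_not] at hnbad
      obtain ⟨L, _, hL⟩ := hnbad
      obtain ⟨w', hw'⟩ : ∃ w' : K ⊕ L → F.carrier,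
        w' = Sum.elim (Function.update w k₀ a) fun _ => a := ⟨_, rfl⟩
      have hwl : ∀ k, w' (.inl k) = Function.update w k₀ a k := fun k => by rw [hw']; rfl
      have hwr : ∀ l, w' (.inr l) = a := fun l => by rw [hw']; rfl
      refine ih _ ?_ (K ⊕ L) w' ?_ ?_ rfl
      · rw [← hn]
        have : {k | w' k ≠ a} = Sum.inl '' ({k | w k ≠ a} \ {k₀}) := by
          ext (k | l)
          · rw [Sum.inl_injective.mem_set_image]
            by_cases hk : k = k₀ <;> simp [hwl, hk]
          · simp [hwr]
        rw [this, Set.ncard_image_of_injective _ Sum.inl_injective]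
        exact Set.ncard_sdiff_singleton_lt_of_mem hk₀
      · have hsub : F.relSg (G (insert (w k₀) C) L) ⊆
            {u | Sum.elim (Function.update w k₀ a) u ∈ F.relSg (G C (K ⊕ L))} := by
          refine relSg_subset ((F.compatible_relSg _).preimage hid _ ?_) ?_
          · rintro (k | l)
            · exact .inr ⟨_, fun u => rfl⟩
            · exact .inl ⟨l, fun u => rfl⟩
          · rintro u ⟨huD, l, hul⟩
            have hsub' : F.relSg (G C K) ⊆ {x | Sum.elim (Function.update x k₀ a)
                (Function.update u l (x k₀)) ∈ F.relSg (G C (K ⊕ L))} := by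
              refine relSg_subset ((F.compatible_relSg _).preimage hid
                (fun x : K → F.carrier => (Sum.elim (Function.update x k₀ a)
                  (Function.update u l (x k₀)) : K ⊕ L → F.carrier)) ?_) ?_
              · rintro (k | l')
                · by_cases hk : k = k₀
                  · exact .inr ⟨a, fun x => by simp [hk]⟩
                  · exact .inl ⟨k, fun x => by simp [hk]⟩
                · by_cases hl : l' = l
                  · exact .inl ⟨k₀, fun x => by simp [hl]⟩
                  · exact .inr ⟨u l', fun x => by simp [hl]⟩
              · rintro x ⟨hxD, k, hk⟩
                refine subset_relSg _ _ ⟨?_, ?_⟩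
                · rintro (k | l')
                  · by_cases hk : k = k₀
                    · simpa [hk] using haD
                    · simpa [hk] using hxD k
                  · by_cases hl : l' = l
                    · simpa [hl] using hxD k₀
                    · simpa [hl] using huD l'
                · by_cases hkk : k = k₀
                  · exact ⟨.inr l, by simpa [← hkk] using hk⟩
                  · exact ⟨.inl k, by simpa [hkk] using hk⟩
            rcases hul with hul | hul
            · have := hsub' hw
              rw [Set.mem_ofPred_eq, ← hul, Function.update_eq_self] at this
              exact this
            · refine subset_relSg _ _ ⟨?_, .inr l, hul⟩
              rintro (k | l')
              · by_cases hk : k = k₀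
                · simpa [hk] using haD
                · rcases hwk k with h | h
                  · simpa [hk, h] using haD
                  · simpa [hk] using h.1
              · exact huD l'
        exact hw' ▸ hsub hL
      · rintro (k | l)
        · by_cases hk : k = k₀
          · exact .inl (by rw [hwl, hk, Function.update_self])
          · rw [hwl, Function.update_of_ne hk]
            exact hwk k
        · exact .inl (hwr l)
  refine hno C D ⟨hCD, ⟨b, hbC⟩, ⟨a, haD, haC⟩, F.closureSet_isClosed _, fun I _ f x hx => ?_⟩
  have hDcl : ∀ i, F.interp f (fun k => x k i) ∈ D := fun i =>
    F.closureSet_isClosed _ f _ fun k => (hx k).1 i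
  refine ⟨hDcl, by_contra fun hi => ?_⟩
  exact hstep _ I _ (F.compatible_relSg (G C I) f x fun k => subset_relSg _ _ (hx k))
    (fun i => .inr ⟨hDcl i, fun h => hi ⟨i, h⟩⟩) rfl

end UAlgebra

namespace UAlgebra

variable {σ : Signature}

/-! ### From cube identities to edge identities -/

open scoped Classical in
/-- `sel p x y` is `y` if `p` holds and `x` otherwise. -/
noncomputable def sel {α : Type} (p : Prop) (x y : α) : α := if p then y else x

theorem sel_pos {α : Type} {p : Prop} (h : p) (x y : α) : sel p x y = y := if_pos h

theorem sel_neg {α : Type} {p : Prop} (h : ¬ p) (x y : α) : sel p x y = x := if_neg h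

theorem sel_self {α : Type} (p : Prop) (x : α) : sel p x x = x := ite_self x

/-- The operation `f`, of possibly infinite arity, preserves all compatible relations. -/
def Preserves (A : UAlgebra σ) {S : Type} (f : (S → A.carrier) → A.carrier) : Prop :=
  ∀ (J : Type) (R : Set (J → A.carrier)), A.Compatible R → ∀ cols : S → J → A.carrier,
    (∀ s, cols s ∈ R) → (fun j => f fun s => cols s j) ∈ R

theorem exists_preserves_of_mem_relSg {A : UAlgebra σ} {S J : Type} {cols : S → J → A.carrier}
    {z : J → A.carrier} (hz : z ∈ A.relSg (Set.range cols)) :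
    ∃ f, A.Preserves f ∧ ∀ j, f (fun s => cols s j) = z j := by
  refine relSg_subset (R := {z | ∃ f, A.Preserves f ∧ ∀ j, f (fun s => cols s j) = z j}) ?_ ?_ hz
  · intro g x hx
    choose f hf hfx using hx
    refine ⟨fun u => A.interp g fun k => f k u, fun J R hR cols hcols => ?_, fun j => ?_⟩
    · exact hR g _ fun k => hf k J R hR cols hcols
    · exact congrArg (A.interp g) (funext fun k => hfx k j)
  · rintro _ ⟨s, rfl⟩
    exact ⟨fun u => u s, fun J R _ cols hcols => hcols s, fun j => rfl⟩

/-- `f` satisfies the identities given by the labels `lab` of its arguments: for each `i`, it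
returns `x` when the arguments whose label contains `i` are `y` and the others are `x`. -/
structure IsLabelled (A : UAlgebra σ) {I S : Type} (𝒱 : Set (Set I)) (lab : S → Set I)
    (f : (S → A.carrier) → A.carrier) : Prop where
  mem : ∀ s, lab s ∈ 𝒱
  preserves : A.Preserves f
  eq : ∀ i x y, f (fun s => sel (i ∈ lab s) x y) = x

theorem IsLabelled.const {A : UAlgebra σ} {I S : Type} [Nonempty I] {𝒱 : Set (Set I)}
    {lab : S → Set I} {f : (S → A.carrier) → A.carrier} (h : A.IsLabelled 𝒱 lab f)
    (x : A.carrier) : f (fun _ => x) = x := by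
  obtain ⟨i⟩ := ‹Nonempty I›
  simpa only [sel_self] using h.eq i x x

theorem IsLabelled.mem_of_forall {A : UAlgebra σ} {I S : Type} {𝒱 : Set (Set I)}
    {lab : S → Set I} {f : (S → A.carrier) → A.carrier} (h : A.IsLabelled 𝒱 lab f)
    {J : Type} {R : Set (J → A.carrier)} (hR : A.Compatible R) (β : J → I)
    (x y : J → A.carrier) (hmem : ∀ δ ∈ 𝒱, (fun j => sel (β j ∈ δ) (x j) (y j)) ∈ R) :
    x ∈ R := by
  have := h.preserves J R hR (fun s j => sel (β j ∈ lab s) (x j) (y j)) fun s => hmem _ (h.mem s)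
  simpa only [h.eq] using this

theorem exists_isLabelled {A : UAlgebra σ} {I : Type} {𝒱 : Set (Set I)}
    (h : ∀ (J : Type) (R : Set (J → A.carrier)), A.Compatible R → ∀ (β : J → I)
      (x y : J → A.carrier), (∀ δ ∈ 𝒱, (fun j => sel (β j ∈ δ) (x j) (y j)) ∈ R) → x ∈ R) :
    ∃ (S : Type) (lab : S → Set I) (f : (S → A.carrier) → A.carrier), A.IsLabelled 𝒱 lab f := by
  obtain ⟨f, hf, hfz⟩ := exists_preserves_of_mem_relSg
    (h (I × A.carrier × A.carrier) (A.relSg (Set.range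
      fun (δ : 𝒱) j => sel (j.1 ∈ δ.1) j.2.1 j.2.2))
      (A.compatible_relSg _) Prod.fst (fun j => j.2.1) (fun j => j.2.2)
      fun δ hδ => A.subset_relSg _ ⟨⟨δ, hδ⟩, rfl⟩)
  exact ⟨𝒱, fun δ => δ.1, f, fun s => s.2, hf, fun i x y => hfz (i, x, y)⟩

/-- The nonempty subsets of `M` together with all singletons. -/
def cubeLabels {I : Type} (M : Set I) : Set (Set I) :=
  {δ | δ.Nonempty ∧ (δ ⊆ M ∨ ∃ i, δ = {i})}

theorem singleton_mem_cubeLabels {I : Type} (M : Set I) (i : I) : {i} ∈ cubeLabels M :=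
  ⟨Set.singleton_nonempty i, .inr ⟨i, rfl⟩⟩

theorem exists_isLabelled_univ {A : UAlgebra σ} [Finite A.carrier] (hid : A.Idempotent)
    (hno : ∀ C D, ¬ A.IsBlocker C D) :
    ∃ (I : Type) (_ : Finite I) (_ : Nontrivial I) (S : Type) (lab : S → Set I)
      (f : (S → A.carrier) → A.carrier), A.IsLabelled (cubeLabels Set.univ) lab f := by
  let F : UAlgebra σ := UAlgebra.pi fun _ : A.carrier × A.carrier => A
  have : Finite F.carrier := inferInstanceAs (Finite (A.carrier × A.carrier → A.carrier))
  obtain ⟨I, _, hI⟩ := exists_const_mem_relSg (F := F) (hid.pi _)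
    (fun C D => not_isBlocker_pi hid hno C D) Prod.fst Prod.snd
  refine ⟨I ⊕ Bool, inferInstance, ⟨.inr true, .inr false, by simp⟩,
    exists_isLabelled fun J R hR β x y hmem => ?_⟩
  have hcomp : F.Compatible {u : I → F.carrier |
      (fun j => Sum.elim (fun i => u i (x j, y j)) (fun _ => x j) (β j)) ∈ R} := by
    intro g u hu
    have := hR g _ hu
    rw [Set.mem_ofPred_eq]
    convert this using 1
    funext j
    cases β j with
    | inl i => rfl
    | inr c => exact (hid g _).symm
  have h := relSg_subset hcomp ?_ hI
  · change (fun j => Sum.elim (fun _ => x j) (fun _ => x j) (β j)) ∈ R at h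
    convert h using 1
    funext j
    cases β j <;> rfl
  · rintro u ⟨hu, i₀, hi₀⟩
    rw [Set.mem_ofPred_eq]
    convert hmem (Sum.inl '' {i | u i = Prod.snd}) ⟨⟨_, i₀, hi₀, rfl⟩, .inl (Set.subset_univ _)⟩
      using 1
    funext j
    cases hβ : β j with
    | inl i =>
      by_cases h : u i = Prod.snd
      · rw [sel_pos ⟨i, h, rfl⟩]
        simp [h]
      · rw [sel_neg (by simpa using h)]
        simp [(hu i).resolve_right h]
    | inr c =>
      rw [sel_neg (by simp)]
      rfl

theorem IsLabelled.exists_of_insert {A : UAlgebra σ} {I S : Type} {N : Set I} {m : I}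
    (hm : m ∉ N) (hN : N.Nontrivial) {lab : S → Set I} {f : (S → A.carrier) → A.carrier}
    (h : A.IsLabelled (cubeLabels (insert m N)) lab f) :
    ∃ (S : Type) (lab : S → Set I) (f : (S → A.carrier) → A.carrier),
      A.IsLabelled (cubeLabels N) lab f := by
  have : Nonempty I := ⟨m⟩
  refine exists_isLabelled fun J R hR β x y hmem => ?_
  have happ : ∀ κ : S → Set I, (∀ s, κ s ∈ cubeLabels N) →
      (fun j => f fun s => sel (β j ∈ κ s) (x j) (y j)) ∈ R := fun κ hκ =>
    h.preserves J R hR _ fun s => hmem _ (hκ s)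
  have hlab : ∀ s, ((lab s ∩ N).Nonempty ∧ lab s ⊆ insert m N) ∨ lab s = {m} ∨
      ∃ l, l ∉ insert m N ∧ lab s = {l} := by
    intro s
    by_cases hs : (lab s ∩ N).Nonempty
    · refine .inl ⟨hs, ?_⟩
      rcases (h.mem s).2 with h' | ⟨i, hi⟩
      · exact h'
      · obtain ⟨n, hn, hnN⟩ := hs
        rw [hi] at hn ⊢
        rcases hn with rfl
        exact Set.singleton_subset_iff.2 (.inr hnN)
    · rcases (h.mem s).2 with h' | ⟨i, hi⟩
      · refine .inr (.inl ((h.mem s).1.subset_singleton_iff.1 fun i hi => ?_))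
        exact (h' hi).resolve_right fun hiN => hs ⟨i, hi, hiN⟩
      · by_cases him : i = m
        · exact .inr (.inl (him ▸ hi))
        · refine .inr (.inr ⟨i, ?_, hi⟩)
          rintro (h' | h')
          · exact him h'
          · exact hs ⟨i, hi ▸ rfl, h'⟩
  obtain ⟨t, htN, htm, ht⟩ : ∃ t : J → A.carrier,
      (∀ j, β j ∈ N → t j = f fun s => sel (lab s ∩ N).Nonempty (x j) (y j)) ∧
      (∀ j, β j = m → t j = f fun s => sel (lab s = {m}) (x j) (y j)) ∧
      ∀ j, β j ∉ insert m N → t j = y j := by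
    classical
    refine ⟨fun j => if β j ∈ N then f fun s => sel (lab s ∩ N).Nonempty (x j) (y j) else
      if β j = m then f fun s => sel (lab s = {m}) (x j) (y j) else y j, ?_, ?_, ?_⟩
    · intro j hj
      exact if_pos hj
    · intro j hj
      have : β j ∉ N := hj ▸ hm
      simp only [if_neg this, if_pos hj]
    · intro j hj
      rw [Set.mem_insert_iff, not_or] at hj
      simp only [if_neg hj.1, if_neg hj.2]
  have hsub : ∀ ε ⊆ N, ε.Nonempty → (∃ n ∈ N, n ∉ ε) →
      (fun j => sel (β j ∈ ε) (x j) (t j)) ∈ R := by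
    rintro ε hεN hε ⟨n₀, hn₀, hn₀ε⟩
    have := happ (fun s => {i | (i ∈ ε ∧ (lab s ∩ N).Nonempty) ∨ (i = n₀ ∧ m ∈ lab s) ∨
      (i ∉ insert m N ∧ i ∈ lab s)}) fun s => ?_
    · convert this using 1
      funext j
      by_cases hjε : β j ∈ ε
      · rw [sel_pos hjε, htN j (hεN hjε)]
        congr 1
        funext s
        congr 1
        have h1 : β j ≠ n₀ := fun e => hn₀ε (e ▸ hjε)
        have h2 : β j ∈ insert m N := .inr (hεN hjε)
        rw [Set.mem_ofPred_eq]
        simp only [hjε, h1, h2, true_and, false_and, not_true_eq_false, or_false]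
      · rw [sel_neg hjε]
        by_cases hjn : β j = n₀
        · conv_lhs => rw [← h.eq m (x j) (y j)]
          congr 1
          funext s
          congr 1
          simp [hjn, hn₀ε, hn₀]
        · by_cases hjM : β j ∈ insert m N
          · conv_lhs => rw [← h.const (x j)]
            congr 1
            funext s
            refine (sel_neg ?_ _ _).symm
            rw [Set.mem_ofPred_eq]
            simp only [hjε, hjn, hjM, false_and, not_true_eq_false, or_false, not_false_eq_true]
          · conv_lhs => rw [← h.eq (β j) (x j) (y j)]
            congr 1
            funext s
            congr 1
            rw [Set.mem_ofPred_eq]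
            simp only [hjε, hjn, hjM, false_and, false_or, not_false_eq_true, true_and]
    · obtain ⟨e, he⟩ := hε
      rcases hlab s with ⟨hs, hsM⟩ | hs | ⟨l, hl, hs⟩
      · refine ⟨⟨e, .inl ⟨he, hs⟩⟩, .inl ?_⟩
        rintro i (hi | hi | hi)
        · exact hεN hi.1
        · exact hi.1 ▸ hn₀
        · exact absurd (hsM hi.2) hi.1
      · refine ⟨⟨n₀, .inr (.inl ⟨rfl, hs ▸ rfl⟩)⟩, .inl ?_⟩
        rintro i (hi | hi | hi)
        · exact hεN hi.1
        · exact hi.1 ▸ hn₀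
        · rw [hs] at hi
          exact absurd (.inl hi.2) hi.1
      · convert singleton_mem_cubeLabels N l using 1
        ext i
        rw [Set.mem_insert_iff, not_or] at hl
        simp only [hs, Set.mem_ofPred_eq, Set.mem_singleton_iff, Set.mem_insert_iff]
        constructor
        · rintro (hi | hi | hi)
          · obtain ⟨k, rfl, hk⟩ := hi.2
            exact absurd hk hl.2
          · exact absurd hi.2.symm hl.1
          · exact hi.2
        · rintro rfl
          exact .inr (.inr ⟨by simpa using hl, rfl⟩)
  refine h.mem_of_forall hR β x t fun δ hδ => ?_
  by_cases hδM : δ ⊆ insert m N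
  swap
  · obtain ⟨l, rfl⟩ := hδ.2.resolve_left hδM
    rw [Set.singleton_subset_iff] at hδM
    convert hmem {l} (singleton_mem_cubeLabels N l) using 1
    funext j
    by_cases hj : β j = l
    · rw [ht j (hj ▸ hδM)]
    · rw [sel_neg (by simpa using hj), sel_neg (by simpa using hj)]
  by_cases hmδ : m ∈ δ
  · have := happ (fun s => {i | (i ∈ δ ∩ N ∧ (lab s ∩ N).Nonempty) ∨ (i ∈ N \ δ ∧ i ∈ lab s) ∨
      (i = m ∧ lab s = {m}) ∨ (i ∉ insert m N ∧ i ∈ lab s)}) fun s => ?_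
    · convert this using 1
      funext j
      by_cases hjm : β j = m
      · rw [sel_pos (hjm ▸ hmδ), htm j hjm]
        congr 1
        funext s
        congr 1
        simp [hjm, hm]
      by_cases hjN : β j ∈ N
      · by_cases hjδ : β j ∈ δ
        · rw [sel_pos hjδ, htN j hjN]
          congr 1
          funext s
          congr 1
          simp [hjm, hjN, hjδ]
        · rw [sel_neg hjδ]
          conv_lhs => rw [← h.eq (β j) (x j) (y j)]
          congr 1
          funext s
          congr 1
          simp [hjm, hjN, hjδ]
      · have hjM : β j ∉ insert m N := by simp [hjm, hjN]
        rw [sel_neg fun hj => hjM (hδM hj)]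
        conv_lhs => rw [← h.eq (β j) (x j) (y j)]
        congr 1
        funext s
        congr 1
        simp [hjm, hjN]
    · rcases hlab s with ⟨⟨n, hn, hnN⟩, hsM⟩ | hs | ⟨l, hl, hs⟩
      · have hsm : lab s ≠ {m} := by
          rintro hs
          rw [hs] at hn
          exact hm (hn ▸ hnN)
        refine ⟨⟨n, ?_⟩, .inl ?_⟩
        · by_cases hnδ : n ∈ δ
          · exact .inl ⟨⟨hnδ, hnN⟩, n, hn, hnN⟩
          · exact .inr (.inl ⟨⟨hnN, hnδ⟩, hn⟩)
        · rintro i (hi | hi | hi | hi)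
          · exact hi.1.2
          · exact hi.1.1
          · exact absurd hi.2 hsm
          · exact absurd (hsM hi.2) hi.1
      · convert singleton_mem_cubeLabels N m using 1
        ext i
        simp only [hs, Set.mem_ofPred_eq, Set.mem_singleton_iff, Set.mem_insert_iff]
        constructor
        · rintro (hi | hi | hi | hi)
          · obtain ⟨k, rfl, hk⟩ := hi.2
            exact absurd hk hm
          · exact hi.2
          · exact hi.1
          · exact hi.2
        · rintro rfl
          exact .inr (.inr (.inl ⟨rfl, trivial⟩))
      · convert singleton_mem_cubeLabels N l using 1
        ext i
        rw [Set.mem_insert_iff, not_or] at hl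
        simp only [hs, Set.mem_ofPred_eq, Set.mem_singleton_iff, Set.mem_insert_iff]
        constructor
        · rintro (hi | hi | hi | hi)
          · obtain ⟨k, rfl, hk⟩ := hi.2
            exact absurd hk hl.2
          · exact hi.2
          · exact absurd (Set.singleton_eq_singleton_iff.1 hi.2) hl.1
          · exact hi.2
        · rintro rfl
          exact .inr (.inr (.inr ⟨by simpa using hl, rfl⟩))
  have hδN : δ ⊆ N := fun i hi => (hδM hi).resolve_left fun e => hmδ (e ▸ hi)
  by_cases hδ' : ∃ n ∈ N, n ∉ δ
  · exact hsub δ hδN hδ.1 hδ'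
  push Not at hδ'
  obtain rfl : δ = N := hδN.antisymm hδ'
  obtain ⟨n, hn, n', hn', hnn'⟩ := hN
  have hw₁ := hsub (δ \ {n}) Set.sdiff_subset ⟨n', hn', hnn'.symm⟩ ⟨n, hn, by simp⟩
  have hw₂ : (fun j => sel (β j = n) (sel (β j ∈ δ \ {n}) (x j) (t j)) (y j)) ∈ R := by
    have := happ (fun s => {i | i = n ∨ (i ∈ δ \ {n} ∧ (lab s ∩ δ).Nonempty)}) fun s => ?_
    · convert this using 1
      funext j
      by_cases hj : β j = n
      · rw [sel_pos hj]
        conv_lhs => rw [← h.const (y j)]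
        congr 1
        funext s
        exact (sel_pos (.inl hj) _ _).symm
      · rw [sel_neg hj]
        by_cases hjδ : β j ∈ δ
        · rw [sel_pos ⟨hjδ, hj⟩, htN j hjδ]
          congr 1
          funext s
          congr 1
          simp [hj, hjδ]
        · rw [sel_neg fun h => hjδ h.1]
          conv_lhs => rw [← h.const (x j)]
          congr 1
          funext s
          exact (sel_neg (by simp [hj, hjδ]) _ _).symm
    · refine ⟨⟨n, .inl rfl⟩, .inl ?_⟩
      rintro i (rfl | hi)
      exacts [hn, hi.1.1]
  have := h.preserves J R hR (fun s j => sel (β j = n ∧ (lab s ∩ δ).Nonempty)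
    (sel (β j ∈ δ \ {n}) (x j) (t j)) (y j)) fun s => ?_
  · convert this using 1
    funext j
    by_cases hj : β j = n
    · have hjδ : β j ∈ δ := hj ▸ hn
      rw [sel_pos hjδ, htN j hjδ]
      congr 1
      funext s
      rw [sel_neg (p := β j ∈ δ \ {n}) (by simp [hj])]
      congr 1
      simp [hj]
    · conv_lhs => rw [← h.const (sel _ _ _)]
      congr 1
      funext s
      rw [sel_neg (p := _ ∧ _) (fun h => hj h.1)]
      congr 1
      simp [hj]
  · by_cases hs : (lab s ∩ δ).Nonempty
    · simpa only [hs, and_true] using hw₂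
    · simpa only [hs, and_false, sel_neg not_false] using hw₁

theorem IsLabelled.exists_pair {A : UAlgebra σ} {I : Type} [Finite I] (n : ℕ) {M : Set I}
    (hM : M.ncard = n + 2) {S : Type} {lab : S → Set I} {f : (S → A.carrier) → A.carrier}
    (h : A.IsLabelled (cubeLabels M) lab f) :
    ∃ p q : I, p ≠ q ∧ ∃ (S : Type) (lab : S → Set I) (f : (S → A.carrier) → A.carrier),
      A.IsLabelled (cubeLabels {p, q}) lab f := by
  induction n generalizing M S with
  | zero =>
    obtain ⟨p, q, hpq, rfl⟩ := Set.ncard_eq_two.1 hM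
    exact ⟨p, q, hpq, S, lab, f, h⟩
  | succ n ih =>
    obtain ⟨m, N, hm, rfl, hN⟩ := (Set.ncard_eq_succ (Set.toFinite M)).1 hM
    obtain ⟨S', lab', f', h'⟩ := h.exists_of_insert hm
      (Set.one_lt_ncard_iff_nontrivial.1 (by omega))
    exact ih hN h'

end UAlgebra

namespace UAlgebra

variable {σ : Signature}

/-! ### The parallelogram property -/

theorem mem_cubeLabels_pair {I : Type} {p q : I} {δ : Set I} (h : δ ∈ cubeLabels {p, q}) :
    δ = {p} ∨ δ = {q} ∨ δ = {p, q} ∨ ∃ l, l ≠ p ∧ l ≠ q ∧ δ = {l} := by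
  rcases h.2 with h' | ⟨l, rfl⟩
  · rcases Set.subset_pair_iff_eq.1 h' with rfl | rfl | rfl | rfl
    · exact absurd h.1 Set.not_nonempty_empty
    · exact .inl rfl
    · exact .inr (.inl rfl)
    · exact .inr (.inr (.inl rfl))
  · by_cases hp : l = p
    · exact .inl (hp ▸ rfl)
    by_cases hq : l = q
    · exact .inr (.inl (hq ▸ rfl))
    exact .inr (.inr (.inr ⟨l, hp, hq, rfl⟩))

theorem IsLabelled.exists_combination {A : UAlgebra σ} {I S ι : Type} {p q : I}
    {lab : S → Set I} {f : (S → A.carrier) → A.carrier}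
    (h : A.IsLabelled (cubeLabels {p, q}) lab f) {R : Set (ι → A.carrier)}
    (hR : A.Compatible R) {xp xq xpq : ι → A.carrier} {x : I → ι → A.carrier} (hp : xp ∈ R)
    (hq : xq ∈ R) (hpq : xpq ∈ R) (hx : ∀ l, x l ∈ R) :
    ∃ u ∈ R, ∀ (k : ι) (P : Set I → Prop) (a b : A.carrier), xp k = sel (P {p}) a b →
      xq k = sel (P {q}) a b → xpq k = sel (P {p, q}) a b →
      (∀ l, l ≠ p → l ≠ q → x l k = sel (P {l}) a b) →
      u k = f fun s => sel (P (lab s)) a b := by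
  have : ∀ s, ∃ c ∈ R, ∀ (k : ι) (P : Set I → Prop) (a b : A.carrier), xp k = sel (P {p}) a b →
      xq k = sel (P {q}) a b → xpq k = sel (P {p, q}) a b →
      (∀ l, l ≠ p → l ≠ q → x l k = sel (P {l}) a b) → c k = sel (P (lab s)) a b := by
    intro s
    rcases mem_cubeLabels_pair (h.mem s) with hs | hs | hs | ⟨l, hlp, hlq, hs⟩ <;> rw [hs]
    · exact ⟨xp, hp, fun k P a b h _ _ _ => h⟩
    · exact ⟨xq, hq, fun k P a b _ h _ _ => h⟩
    · exact ⟨xpq, hpq, fun k P a b _ _ h _ => h⟩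
    · exact ⟨x l, hx l, fun k P a b _ _ _ h => h l hlp hlq⟩
  choose c hc hck using this
  refine ⟨_, h.preserves ι R hR c hc, fun k P a b h1 h2 h3 h4 => ?_⟩
  exact congrArg f (funext fun s => hck s k P a b h1 h2 h3 h4)

theorem IsLabelled.exists_agree {A : UAlgebra σ} {I S ι : Type} {p q : I} (hpq : p ≠ q)
    {lab : S → Set I} {f : (S → A.carrier) → A.carrier}
    (h : A.IsLabelled (cubeLabels {p, q}) lab f) {R : Set (ι → A.carrier)}
    (hR : A.Compatible R) {T : Set ι} {i : ι} {g r w w' : ι → A.carrier}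
    (hr : r ∈ R) (hrg : ∀ k ∈ T, k ≠ i → r k = g k) (hw : w ∈ R) (hw' : w' ∈ R)
    (hww' : ∀ k ∈ T, k ≠ i → w k = w' k) (hwi : w i = r i) (hwi' : w' i = g i)
    {j : I → ι} (hj : Function.Injective j) (hji : ∀ l, j l ≠ i) {v : I → ι → A.carrier}
    (hv : ∀ l, v l ∈ R) (hvg : ∀ l, ∀ k ∈ T, k ≠ j l → v l k = g k) (hi : i ∈ T) :
    ∃ u ∈ R, ∀ k ∈ T, u k = g k := by
  have : Nonempty I := ⟨p⟩
  have hqp : ({q} : Set I) ≠ {p} := fun e => hpq (Set.singleton_eq_singleton_iff.1 e).symm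
  have hpqp : ({p, q} : Set I) ≠ {p} := fun e =>
    hpq (Set.mem_singleton_iff.1 (e ▸ Set.mem_insert_of_mem p rfl : q ∈ ({p} : Set I))).symm
  have hlp : ∀ l, l ≠ p → ({l} : Set I) ≠ {p} := fun l hl e =>
    hl (Set.singleton_eq_singleton_iff.1 e)
  have hvi : ∀ l, v l i = g i := fun l => hvg l i hi (hji l).symm
  obtain ⟨r', hr', hr'k⟩ := h.exists_combination hR hr (hv q) (hv q) hv
  have hr'i := hr'k i (· = {p}) (g i) (r i) (by simp [sel]) (by simp [sel, hqp, hvi])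
    (by simp [sel, hpqp, hvi]) fun l hl _ => by simp [sel, hl, hvi]
  have hr'g : ∀ k ∈ T, k ≠ i → r' k = g k := by
    intro k hk hki
    by_cases hkj : ∃ l, l ≠ p ∧ k = j l
    · obtain ⟨l, hl, rfl⟩ := hkj
      rw [hr'k (j l) (l ∈ ·) (g (j l)) (v l (j l)), h.eq]
      · simp [sel, hl, hrg _ hk hki]
      · by_cases hlq : l = q
        · simp [sel, hlq]
        · simp [sel, hlq, hvg q _ hk (hj.ne hlq)]
      · by_cases hlq : l = q
        · simp [sel, hlq]
        · simp [sel, hl, hlq, hvg q _ hk (hj.ne hlq)]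
      · intro l' _ _
        by_cases hll : l = l'
        · simp [sel, hll]
        · simp [sel, hll, hvg l' _ hk (hj.ne hll)]
    · have hv' : ∀ l, l ≠ p → v l k = g k := fun l hl =>
        hvg l k hk fun e => hkj ⟨l, hl, e⟩
      rw [hr'k k (fun _ => False) (g k) (g k) (by simp [sel, hrg k hk hki])
        (by simp [sel, hv' q hpq.symm]) (by simp [sel, hv' q hpq.symm])
        fun l hl _ => by simp [sel, hv' l hl]]
      simpa only [sel_self] using h.const (g k)
  obtain ⟨v', hv', hv'k⟩ := h.exists_combination hR hw (hv p) hw' fun _ => hv p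
  have hv'i := hv'k i (· = {p}) (g i) (r i) (by simp [sel, hwi]) (by simp [sel, hqp, hvi])
    (by simp [sel, hpqp, hwi']) fun l hl _ => by simp [sel, hl, hvi]
  have hv'g : ∀ k ∈ T, k ≠ i → v' k = v p k := by
    intro k hk hki
    rw [hv'k k (p ∈ ·) (v p k) (w k) (by simp [sel]) (by simp [sel, hpq])
      (by simp [sel, hww' k hk hki]) fun l hl _ => by simp [sel, hl.symm], h.eq]
  obtain ⟨u, hu, huk⟩ := h.exists_combination hR (hv p) hr' hv' hv
  refine ⟨u, hu, fun k hk => ?_⟩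
  by_cases hki : k = i
  · subst hki
    rw [huk k (q ∈ ·) (g k) (r' k) (by simp [sel, hpq.symm, hvi]) (by simp [sel])
      (by simp [sel, hv'i, hr'i]) fun l _ hl => by simp [sel, hl.symm, hvi], h.eq]
  · by_cases hkj : ∃ l, l ≠ q ∧ k = j l
    · obtain ⟨l, hl, rfl⟩ := hkj
      have hvl : v p (j l) = sel (l = p) (g (j l)) (v l (j l)) := by
        by_cases hlp : l = p
        · simp [sel, hlp]
        · simp [sel, hlp, hvg p _ hk (hj.ne hlp)]
      rw [huk (j l) (l ∈ ·) (g (j l)) (v l (j l)), h.eq]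
      · simpa using hvl
      · simp [sel, hl, hr'g _ hk hki]
      · rw [hv'g _ hk hki]
        simpa [hl] using hvl
      · intro l' _ _
        by_cases hll : l = l'
        · simp [sel, hll]
        · simp [sel, hll, hvg l' _ hk (hj.ne hll)]
    · have hv' : ∀ l, l ≠ q → v l k = g k := fun l hl =>
        hvg l k hk fun e => hkj ⟨l, hl, e⟩
      rw [huk k (fun _ => False) (g k) (g k) (by simp [sel, hv' p hpq])
        (by simp [sel, hr'g k hk hki]) (by simp [sel, hv'g k hk hki, hv' p hpq])
        fun l _ hl => by simp [sel, hv' l hl]]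
      simpa only [sel_self] using h.const (g k)

end UAlgebra

namespace UAlgebra

variable {σ : Signature}

/-! ### Compact representations -/

theorem IsLabelled.subset_of_forks {A : UAlgebra σ} {I S : Type} [Finite I] {p q : I}
    (hpq : p ≠ q) {lab : S → Set I} {f : (S → A.carrier) → A.carrier}
    (h : A.IsLabelled (cubeLabels {p, q}) lab f) {n : ℕ} {R R' : Set (Fin n → A.carrier)}
    (hR : A.Compatible R) (hRR' : R ⊆ R')
    (hproj : ∀ (τ : Fin (Nat.card I) → Option (Fin n)), ∀ g ∈ R', ∃ r ∈ R, ∀ l k,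
      τ l = some k → r k = g k)
    (hfork : ∀ (i : Fin n), ∀ w ∈ R', ∀ w' ∈ R', (∀ k < i, w k = w' k) →
      ∃ z ∈ R, ∃ z' ∈ R, (∀ k < i, z k = z' k) ∧ z i = w i ∧ z' i = w' i) : R' ⊆ R := by
  classical
  have hproj' : ∀ T : Finset (Fin n), T.card ≤ Nat.card I → ∀ g ∈ R', ∃ r ∈ R,
      ∀ k ∈ T, r k = g k := by
    intro T hT g hg
    obtain ⟨r, hr, hrg⟩ := hproj (fun l => T.toList[l.val]?) g hg
    refine ⟨r, hr, fun k hk => ?_⟩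
    obtain ⟨l, hl⟩ := List.mem_iff_getElem?.1 (Finset.mem_toList.2 hk)
    have hlt : l < T.toList.length := (List.getElem?_eq_some_iff.1 hl).1
    rw [Finset.length_toList] at hlt
    exact hrg ⟨l, hlt.trans_le hT⟩ k hl
  have hseg : ∀ m : ℕ, ∀ g ∈ R', ∃ r ∈ R, ∀ k : Fin n, k.val < m → r k = g k := by
    intro m
    induction m with
    | zero =>
      intro g hg
      obtain ⟨r, hr, -⟩ := hproj' ∅ (by simp) g hg
      exact ⟨r, hr, fun k hk => absurd hk (Nat.not_lt_zero _)⟩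
    | succ m ihm =>
      intro g hg
      obtain ⟨r, hr, hrg⟩ := ihm g hg
      by_cases hm : m < n
      swap
      · exact ⟨r, hr, fun k _ => hrg k (by omega)⟩
      have key : ∀ T : Finset (Fin n), (∀ k ∈ T, k.val < m + 1) →
          ∃ u ∈ R, ∀ k ∈ T, u k = g k := by
        intro T
        induction T using Finset.strongInduction with
        | H T ihT =>
          intro hTm
          have hlt : ∀ k ∈ T, k ≠ ⟨m, hm⟩ → k.val < m := fun k hk hkm =>
            lt_of_le_of_ne (Nat.lt_succ_iff.1 (hTm k hk)) fun e => hkm (Fin.ext e)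
          by_cases hi : (⟨m, hm⟩ : Fin n) ∈ T
          swap
          · exact ⟨r, hr, fun k hk => hrg k (hlt k hk fun e => hi (e ▸ hk))⟩
          by_cases hT : T.card ≤ Nat.card I
          · exact hproj' T hT g hg
          have := Fintype.ofFinite I
          obtain ⟨j⟩ := Function.Embedding.nonempty_of_card_le (α := I)
            (β := T.erase (⟨m, hm⟩ : Fin n)) (by
              rw [Fintype.card_coe, Finset.card_erase_of_mem hi, ← Nat.card_eq_fintype_card]
              omega)
          have hjT : ∀ l, (j l).1 ∈ T := fun l => Finset.mem_of_mem_erase (j l).2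
          choose v hv hvg using fun l => ihT (T.erase (j l).1) (Finset.erase_ssubset (hjT l))
            fun k hk => hTm k (Finset.mem_of_mem_erase hk)
          obtain ⟨z, hz, z', hz', hzz', hzi, hzi'⟩ := hfork ⟨m, hm⟩ r (hRR' hr) g hg
            fun k hk => hrg k hk
          obtain ⟨u, hu, hug⟩ := h.exists_agree hpq hR (T := {k | k ∈ T}) (g := g) hr
            (fun k hk hki => hrg k (hlt k hk hki)) hz hz'
            (fun k hk hki => hzz' k (hlt k hk hki)) hzi hzi' (j := fun l => (j l).1)
            (fun l l' e => j.injective (Subtype.ext e))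
            (fun l => Finset.ne_of_mem_erase (j l).2) hv
            (fun l k hk hkj => hvg l k (Finset.mem_erase.2 ⟨hkj, hk⟩)) hi
          exact ⟨u, hu, hug⟩
      obtain ⟨u, hu, hug⟩ := key (Finset.univ.filter fun k => k.val < m + 1) (by simp)
      exact ⟨u, hu, fun k hk => hug k (by simpa using hk)⟩
  intro g hg
  obtain ⟨r, hr, hrg⟩ := hseg n g hg
  have : r = g := funext fun k => hrg k k.2
  exact this ▸ hr

/-- Indices of a family of generators of a compatible relation of arity `n`: prescribed values
at `K` coordinates, and forks. -/
abbrev GenIndex (α : Type) (K n : ℕ) : Type :=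
  ((Fin K → Option (Fin n)) × (Fin K → α)) ⊕ (Fin n × α × α × Bool)

theorem IsLabelled.exists_generators {A : UAlgebra σ} {I S : Type} [Finite I] {p q : I}
    (hA : Nonempty A.carrier) (hpq : p ≠ q) {lab : S → Set I} {f : (S → A.carrier) → A.carrier}
    (h : A.IsLabelled (cubeLabels {p, q}) lab f) {n : ℕ} {R : Set (Fin n → A.carrier)}
    (hne : R.Nonempty) (hR : A.Compatible R) :
    ∃ gens : GenIndex A.carrier (Nat.card I) n → Fin n → A.carrier,
      A.relSg (Set.range gens) = R := by
  obtain ⟨r₀, hr₀⟩ := hne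
  have hproj : ∀ (x : (Fin (Nat.card I) → Option (Fin n)) × (Fin (Nat.card I) → A.carrier)),
      ∃ u ∈ R, ∀ g ∈ R, (∀ l k, x.1 l = some k → g k = x.2 l) →
        ∀ l k, x.1 l = some k → u k = x.2 l := by
    intro x
    by_cases hx : ∃ g ∈ R, ∀ l k, x.1 l = some k → g k = x.2 l
    · obtain ⟨u, hu, hux⟩ := hx
      exact ⟨u, hu, fun _ _ _ => hux⟩
    · exact ⟨r₀, hr₀, fun g hg hgx => absurd ⟨g, hg, hgx⟩ hx⟩
  have hfork : ∀ (x : Fin n × A.carrier × A.carrier), ∃ z ∈ R, ∃ z' ∈ R,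
      ∀ w ∈ R, ∀ w' ∈ R, (∀ k < x.1, w k = w' k) → w x.1 = x.2.1 → w' x.1 = x.2.2 →
        (∀ k < x.1, z k = z' k) ∧ z x.1 = x.2.1 ∧ z' x.1 = x.2.2 := by
    intro x
    by_cases hx : ∃ z ∈ R, ∃ z' ∈ R, (∀ k < x.1, z k = z' k) ∧ z x.1 = x.2.1 ∧ z' x.1 = x.2.2
    · obtain ⟨z, hz, z', hz', hzz'⟩ := hx
      exact ⟨z, hz, z', hz', fun _ _ _ _ _ _ _ => hzz'⟩
    · exact ⟨r₀, hr₀, r₀, hr₀, fun w hw w' hw' h1 h2 h3 =>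
        absurd ⟨w, hw, w', hw', h1, h2, h3⟩ hx⟩
  choose u hu hux using hproj
  choose z hz z' hz' hzz' using hfork
  let gens : GenIndex A.carrier (Nat.card I) n → Fin n → A.carrier := Sum.elim u
    fun y => if y.2.2.2 then z' (y.1, y.2.1, y.2.2.1) else z (y.1, y.2.1, y.2.2.1)
  have hsub : A.relSg (Set.range gens) ⊆ R := by
    refine relSg_subset hR ?_
    rintro _ ⟨x | ⟨i, a, b, c⟩, rfl⟩
    · exact hu x
    · cases c
      · exact hz (i, a, b)
      · exact hz' (i, a, b)
  refine ⟨gens, hsub.antisymm (h.subset_of_forks hpq (A.compatible_relSg _) hsub ?_ ?_)⟩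
  · intro τ g hg
    obtain ⟨val, hval⟩ : ∃ val : Fin (Nat.card I) → A.carrier, ∀ l k, τ l = some k →
        g k = val l := by
      refine ⟨fun l => (τ l).elim hA.some g, fun l k hlk => ?_⟩
      simp [hlk]
    exact ⟨_, A.subset_relSg _ ⟨.inl (τ, val), rfl⟩, fun l k hlk =>
      (hux (τ, val) g hg hval l k hlk).trans (hval l k hlk).symm⟩
  · intro i w hw w' hw' hww'
    exact ⟨_, A.subset_relSg _ ⟨.inr (i, w i, w' i, false), rfl⟩, _,
      A.subset_relSg _ ⟨.inr (i, w i, w' i, true), rfl⟩,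
      hzz' (i, w i, w' i) w hw w' hw' hww' rfl rfl⟩

end UAlgebra

namespace UAlgebra

variable {σ : Signature}

theorem IsLabelled.exists_polynomial {A : UAlgebra σ} [Finite A.carrier] {I S : Type} [Finite I]
    {p q : I} (hA : Nonempty A.carrier) (hpq : p ≠ q) {lab : S → Set I}
    {f : (S → A.carrier) → A.carrier} (h : A.IsLabelled (cubeLabels {p, q}) lab f) :
    ∃ P : Polynomial ℕ, ∀ n : ℕ,
      numSubalgebras (UAlgebra.pi fun _ : Fin n => A) ≤ 2 ^ P.eval n := by
  set α := Nat.card A.carrier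
  set K := Nat.card I
  refine ⟨.C α * .X * ((.X + 1) ^ K * .C (α ^ K) + .X * .C (α * (α * 2))), fun n => ?_⟩
  choose gens hgens using fun R : {R : Set (UAlgebra.pi fun _ : Fin n => A).carrier //
    R.Nonempty ∧ (UAlgebra.pi fun _ : Fin n => A).IsClosed R} =>
      h.exists_generators hA hpq (n := n) R.2.1 R.2.2
  have hinj : Function.Injective gens := fun R R' e =>
    Subtype.ext (by rw [← hgens R, e, hgens R'])
  have hcard : Nat.card (GenIndex A.carrier K n) =
      (n + 1) ^ K * α ^ K + n * (α * (α * 2)) := by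
    simp [Nat.card_sum, Nat.card_prod, Nat.card_fun, Nat.card_eq_fintype_card, α]
  calc numSubalgebras (UAlgebra.pi fun _ : Fin n => A)
      ≤ Nat.card (GenIndex A.carrier K n → Fin n → A.carrier) :=
        Nat.card_le_card_of_injective gens hinj
    _ = (α ^ n) ^ ((n + 1) ^ K * α ^ K + n * (α * (α * 2))) := by
        rw [Nat.card_fun, Nat.card_fun, hcard, Nat.card_fin]
    _ ≤ ((2 ^ α) ^ n) ^ ((n + 1) ^ K * α ^ K + n * (α * (α * 2))) :=
        Nat.pow_le_pow_left (Nat.pow_le_pow_left Nat.lt_two_pow_self.le _) _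
    _ = _ := by
        rw [← pow_mul, ← pow_mul]
        simp [mul_assoc]

end UAlgebra

/-- a finite idempotent algebra omitting type 1 all of whose
edges are of the majority or affine type has few subpowers. -/
theorem stmt_7 (σ : Signature) (A : UAlgebra σ)
    (hfin : Finite A.carrier) (hne : Nonempty A.carrier) (hid : A.Idempotent)
    (h1 : A.OmitsType1)
    (hedge : ∀ a b : A.carrier, A.IsEdge a b → A.IsMajEdge a b ∨ A.IsAffEdge a b) :
    ∃ p : Polynomial ℕ, ∀ n : ℕ,
      UAlgebra.numSubalgebras (UAlgebra.pi (fun _ : Fin n => A)) ≤ 2 ^ (p.eval n) := by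
  have hno := fun C D => h1.not_isBlocker hid (UAlgebra.not_isStrongThinEdge hid hedge) C D
  obtain ⟨I, _, _, _, _, _, hlab⟩ := UAlgebra.exists_isLabelled_univ hid hno
  obtain ⟨m, hm⟩ : ∃ m, (Set.univ : Set I).ncard = m + 2 := by
    rw [Set.ncard_univ]
    exact ⟨Nat.card I - 2, by have := Finite.one_lt_card (α := I); omega⟩
  obtain ⟨p, q, hpq, _, _, _, h⟩ := hlab.exists_pair m hm
  exact h.exists_polynomial hne hpq
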